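/- arXiv:1911.03832 — 7 statements merged into one kernel-verified Lean document; each statement's English description precedes it below -/
import Mathlib

section
/- Consider the Baire space ℕ^ℕ equipped with the metric of least difference. The least cardinality of a subset of ℕ^ℕ that does not have strong measure zero equals cov(M), the least cardinality of a family of meager subsets of ℕ^ℕ whose union is all of ℕ^ℕ. -/
open Set Filter Topology
open scoped ENNReal Pointwise

def SmzGroup {G : Type*} [Group G] [TopologicalSpace G] (S : Set G) : Prop :=
  ∀ U : ℕ → Set G, (∀ n, IsOpen (U n) ∧ (1 : G) ∈ U n) →
    ∃ g : ℕ → G, S ⊆ ⋃ n, g n • U n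

def SmzMetric {X : Type*} [PseudoEMetricSpace X] (S : Set X) : Prop :=
  ∀ ε : ℕ → ℝ, (∀ n, 0 < ε n) →
    ∃ U : ℕ → Set X, S ⊆ (⋃ n, U n) ∧ ∀ n, EMetric.diam (U n) ≤ ENNReal.ofReal (ε n)

structure Submeasure (G : Type*) where
  toFun : Set G → ℝ≥0∞
  empty' : toFun ∅ = 0
  mono' : ∀ ⦃A B : Set G⦄, A ⊆ B → toFun A ≤ toFun B
  subadd' : ∀ A B : Set G, toFun (A ∪ B) ≤ toFun A + toFun B

instance {G : Type*} : CoeFun (Submeasure G) (fun _ => Set G → ℝ≥0∞) := ⟨Submeasure.toFun⟩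

def Submeasure.LeftInvariant {G : Type*} [Group G] (μ : Submeasure G) : Prop :=
  ∀ (g : G) (A : Set G), μ (g • A) = μ A

def Submeasure.OuterRegular {G : Type*} [TopologicalSpace G] (μ : Submeasure G) : Prop :=
  ∀ A : Set G, μ A = ⨅ (U : Set G) (_ : A ⊆ U) (_ : IsOpen U), μ U

def Submeasure.SigmaSubadditive {G : Type*} (μ : Submeasure G) : Prop :=
  ∀ A : ℕ → Set G, μ (⋃ n, A n) ≤ ∑' n, μ (A n)

def Submeasure.Diffuse {G : Type*} (μ : Submeasure G) : Prop :=
  ∀ x : G, μ {x} = 0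

def UniformlyNowhereDense {G : Type*} [Group G] [TopologicalSpace G] (N : Set G) : Prop :=
  ∀ U ∈ 𝓝 (1 : G), ∃ V ∈ 𝓝 (1 : G), ∀ x : G, ∃ g : G, g • V ⊆ (x • U) \ N

def UniformlyMeager {G : Type*} [Group G] [TopologicalSpace G] (M : Set G) : Prop :=
  ∃ N : ℕ → Set G, (∀ n, UniformlyNowhereDense (N n)) ∧ M = ⋃ n, N n

def AntiGMS {G : Type*} [Group G] [TopologicalSpace G] (C : Set G) : Prop :=
  C.Nonempty ∧ IsNowhereDense C ∧
    ∀ U : ℕ → Set G, (∀ n, IsOpen (U n) ∧ (1 : G) ∈ U n) →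
      ∃ g : ℕ → G, ∀ x : G, C ⊆ closure (x • ⋃ n, g n • U n)

def HasInvariantMetric (G : Type*) [Group G] [t : TopologicalSpace G] : Prop :=
  ∃ m : MetricSpace G, m.toUniformSpace.toTopologicalSpace = t ∧
    (∀ x y z : G, m.toDist.dist (z * x) (z * y) = m.toDist.dist x y) ∧
    (∀ x y z : G, m.toDist.dist (x * z) (y * z) = m.toDist.dist x y)

def IsCLI (G : Type*) [Group G] [t : TopologicalSpace G] : Prop :=
  ∃ m : MetricSpace G, m.toUniformSpace.toTopologicalSpace = t ∧
    (@CompleteSpace G m.toUniformSpace) ∧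
    ∀ x y z : G, m.toDist.dist (z * x) (z * y) = m.toDist.dist x y

structure IsGauge (h : ℝ → ℝ) : Prop where
  nonneg : ∀ r, 0 ≤ r → 0 ≤ h r
  mono : MonotoneOn h (Set.Ici 0)
  rightCont : ∀ r : ℝ, 0 ≤ r → ContinuousWithinAt h (Set.Ioi r) r
  zero : h 0 = 0
  pos : ∀ r, 0 < r → 0 < h r

noncomputable def hausdorffH {X : Type*} [PseudoEMetricSpace X] (h : ℝ → ℝ) (E : Set X) : ℝ≥0∞ :=
  ⨆ (δ : ℝ) (_ : 0 < δ),
    ⨅ (U : ℕ → Set X) (_ : E ⊆ ⋃ n, U n)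
      (_ : ∀ n, EMetric.diam (U n) ≤ ENNReal.ofReal δ),
      ∑' n, ENNReal.ofReal (h (EMetric.diam (U n)).toReal)

noncomputable def upperH0 {X : Type*} [PseudoEMetricSpace X] (h : ℝ → ℝ) (E : Set X) : ℝ≥0∞ :=
  ⨆ (δ : ℝ) (_ : 0 < δ),
    ⨅ (N : ℕ) (U : ℕ → Set X) (_ : E ⊆ ⋃ n ∈ Finset.range N, U n)
      (_ : ∀ n ∈ Finset.range N, EMetric.diam (U n) ≤ ENNReal.ofReal δ),
      ∑ n ∈ Finset.range N, ENNReal.ofReal (h (EMetric.diam (U n)).toReal)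

noncomputable def upperH {X : Type*} [PseudoEMetricSpace X] (h : ℝ → ℝ) (E : Set X) : ℝ≥0∞ :=
  ⨅ (A : ℕ → Set X) (_ : E ⊆ ⋃ n, A n), ∑' n, upperH0 h (A n)

def IsGammaGroupableCover {X : Type*} (S : Set X) (U : ℕ → Set X) : Prop :=
  ∃ k : ℕ → ℕ, k 0 = 0 ∧ StrictMono k ∧
    ∀ x ∈ S, ∀ᶠ j in Filter.atTop, ∃ n, k j ≤ n ∧ n < k (j + 1) ∧ x ∈ U n

def SmzSharp {X : Type*} [PseudoEMetricSpace X] (S : Set X) : Prop :=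
  ∀ ε : ℕ → ℝ, (∀ n, 0 < ε n) →
    ∃ U : ℕ → Set X, IsGammaGroupableCover S U ∧
      ∀ n, EMetric.diam (U n) ≤ ENNReal.ofReal (ε n)

noncomputable def covMeager (X : Type*) [TopologicalSpace X] : Cardinal :=
  sInf {c : Cardinal | ∃ 𝒜 : Set (Set X),
    (∀ A ∈ 𝒜, IsMeagre A) ∧ ⋃₀ 𝒜 = Set.univ ∧ Cardinal.mk ↥𝒜 = c}

noncomputable def eqCard : Cardinal :=
  sInf {c : Cardinal | ∃ F : Set (ℕ → ℕ),
    (∃ h : ℕ → ℕ, ∀ f ∈ F, ∀ᶠ n in Filter.atTop, f n ≤ h n) ∧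
    (∀ g : ℕ → ℕ, ∃ f ∈ F, ∀ n, f n ≠ g n) ∧ Cardinal.mk ↥F = c}

/-- Every family of functions indexed by `ι` can be guessed by a single function. -/
def GuessP (ι : Type) : Prop :=
  ∀ F : ι → ℕ → ℕ, ∃ g : ℕ → ℕ, ∀ i, ∃ n, F i n = g n

theorem GuessP.inf {ι : Type} (h : GuessP ι) {β : Type} [Countable β] [Nonempty β]
    (F : ι → ℕ → β) : ∃ g : ℕ → β, ∀ i N, ∃ n, N ≤ n ∧ F i n = g n := by
  obtain ⟨e, he⟩ := exists_injective_nat β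
  have h1 : ∀ m : ℕ, ∃ g : ℕ → ℕ, ∀ i, ∃ n, e (F i (Nat.pair m n)) = g n :=
    fun m => h (fun i n => e (F i (Nat.pair m n)))
  choose g hg using h1
  refine ⟨fun n => Function.invFun e (g (Nat.unpair n).1 (Nat.unpair n).2), fun i N => ?_⟩
  obtain ⟨n, hn⟩ := hg N i
  refine ⟨Nat.pair N n, Nat.left_le_pair N n, ?_⟩
  simp only [Nat.unpair_pair, ← hn]
  exact (Function.leftInverse_invFun he _).symm

theorem GuessP.sel {ι : Type} (h : GuessP ι) {β : Type} [Countable β] [Nonempty β]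
    (X : ι → Set ℕ) (hX : ∀ i, (X i).Infinite) (f : ι → ℕ → β) :
    ∃ g : ℕ → β, ∀ i N, ∃ n, N ≤ n ∧ n ∈ X i ∧ f i n = g n := by
  classical
  have h1 : ∀ i k, ∃ t : Finset ℕ, (t : Set ℕ) ⊆ X i \ Set.Iio k ∧ t.card = k + 1 :=
    fun i k => ((hX i).sdiff (Set.finite_Iio k)).exists_subset_card_eq (k + 1)
  choose T hT hTc using h1
  obtain ⟨G, hG⟩ := h.inf (fun i k => (T i k).image (fun n => (n, f i n)))
  have h2 : ∀ (k : ℕ) (s : Finset ℕ), ∃ p : ℕ × β, p.1 ∉ s ∧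
      (s.card ≤ k → k < ((G k).image Prod.fst).card → p ∈ G k) := by
    intro k s
    by_cases hc : s.card ≤ k ∧ k < ((G k).image Prod.fst).card
    · obtain ⟨n, hn, hns⟩ := Finset.exists_mem_notMem_of_card_lt_card
        (lt_of_le_of_lt hc.1 hc.2)
      obtain ⟨p, hp, rfl⟩ := Finset.mem_image.1 hn
      exact ⟨p, hns, fun _ _ => hp⟩
    · obtain ⟨n, hn⟩ := Infinite.exists_notMem_finset s
      exact ⟨(n, Classical.arbitrary β), hn, fun a b => absurd ⟨a, b⟩ hc⟩
  choose pick hp1 hp2 using h2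
  let acc : ℕ → Finset ℕ := fun k => Nat.rec ∅ (fun k s => insert (pick k s).1 s) k
  have acc_succ : ∀ k, acc (k + 1) = insert (pick k (acc k)).1 (acc k) := fun k => rfl
  have acc_card : ∀ k, (acc k).card ≤ k := by
    intro k
    induction k with
    | zero => simp [acc]
    | succ k ih =>
      rw [acc_succ]
      exact (Finset.card_insert_le _ _).trans (by omega)
  have acc_mono : Monotone acc := by
    apply monotone_nat_of_le_succ
    intro k
    rw [acc_succ]
    exact Finset.subset_insert _ _
  let p : ℕ → ℕ × β := fun k => pick k (acc k)
  have hlt : ∀ k l, k < l → (p k).1 ≠ (p l).1 := by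
    intro k l hkl heq
    apply hp1 l (acc l)
    change (p l).1 ∈ acc l
    rw [← heq]
    apply acc_mono (Nat.succ_le_of_lt hkl)
    rw [Nat.succ_eq_add_one, acc_succ]
    exact Finset.mem_insert_self _ _
  have hinj : Function.Injective (fun k => (p k).1) := by
    intro k l hkl
    rcases lt_trichotomy k l with hh | hh | hh
    · exact absurd hkl (hlt k l hh)
    · exact hh
    · exact absurd hkl.symm (hlt l k hh)
  refine ⟨Function.extend (fun k => (p k).1) (fun k => (p k).2)
    (fun _ => Classical.arbitrary β), fun i N => ?_⟩
  obtain ⟨k, hk, hGk⟩ := hG i N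
  have hcard : k < ((G k).image Prod.fst).card := by
    rw [← hGk, Finset.image_image]
    have : (Prod.fst ∘ fun n => (n, f i n)) = id := rfl
    rw [this, Finset.image_id, hTc]
    omega
  have hmem : p k ∈ G k := hp2 k (acc k) (acc_card k) hcard
  rw [← hGk] at hmem
  obtain ⟨n, hn, hnp⟩ := Finset.mem_image.1 hmem
  have hn' := hT i k hn
  have e1 : (p k).1 = n := by rw [← hnp]
  have e2 : (p k).2 = f i n := by rw [← hnp]
  refine ⟨n, hk.trans (not_lt.1 hn'.2), hn'.1, ?_⟩
  have := hinj.extend_apply (fun k => (p k).2) (fun _ => Classical.arbitrary β) k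
  simp only [e1, e2] at this
  exact this.symm

theorem block_aux {D : Set (ℕ → ℕ)} (hO : IsOpen D) (hD : Dense D) (n : ℕ)
    (Q : Finset (Fin n → ℕ)) :
    ∃ (y : ℕ → ℕ) (m : ℕ), n ≤ m ∧ ∀ z : ℕ → ℕ, (fun j : Fin n => z j) ∈ Q →
      (∀ j, n ≤ j → j < m → z j = y j) → z ∈ D := by
  classical
  induction Q using Finset.induction_on with
  | empty => exact ⟨0, n, le_rfl, fun z hz => by simp at hz⟩
  | insert s Q hs ih =>
    obtain ⟨y, m, hm, H⟩ := ih
    let w : ℕ → ℕ := fun j => if h : j < n then s ⟨j, h⟩ else y j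
    obtain ⟨u, huc, huD⟩ := hD.inter_open_nonempty (PiNat.cylinder w m)
      (PiNat.isOpen_cylinder (fun _ => ℕ) w m) ⟨w, PiNat.self_mem_cylinder w m⟩
    obtain ⟨v, ⟨a, l, rfl⟩, hua, hsub⟩ :=
      (PiNat.isTopologicalBasis_cylinders (fun _ : ℕ => ℕ)).exists_subset_of_mem_open huD hO
    refine ⟨u, max m l, hm.trans (le_max_left _ _), fun z hz hzu => ?_⟩
    rw [Finset.mem_insert] at hz
    rcases hz with hz | hz
    · apply hsub
      intro j hj
      rw [← hua j hj]
      by_cases hjn : j < n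
      · have e1 : z j = s ⟨j, hjn⟩ := congrFun hz ⟨j, hjn⟩
        have e2 := huc j (lt_of_lt_of_le hjn hm)
        rw [e2, e1]
        simp [w, hjn]
      · exact hzu j (not_lt.1 hjn) (lt_of_lt_of_le hj (le_max_right _ _))
    · apply H z hz
      intro j hj hjm
      rw [hzu j hj (lt_of_lt_of_le hjm (le_max_left _ _)), huc j hjm]
      simp [w, not_lt.2 hj]

theorem block {D : Set (ℕ → ℕ)} (hO : IsOpen D) (hD : Dense D) (n : ℕ) :
    ∃ (y : ℕ →₀ ℕ) (m : ℕ), (∀ j, y j < m) ∧ ∀ z : ℕ → ℕ, (∀ j, j < n → z j < n) →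
      (∀ j, n ≤ j → j < m → z j = y j) → z ∈ D := by
  classical
  obtain ⟨y, m, hm, H⟩ := block_aux hO hD n (Fintype.piFinset (fun _ => Finset.range n))
  let y' : ℕ →₀ ℕ := Finsupp.onFinset (Finset.range m) (fun j => if j < m then y j else 0)
    (by intro j hj; by_contra hc; simp at hc; simp [not_lt.2 hc] at hj)
  have hy' : ∀ j, y' j = if j < m then y j else 0 := fun j => rfl
  refine ⟨y', m + 1 + y'.support.sup y', ?_, ?_⟩
  · intro j
    by_cases hj : j ∈ y'.support
    · have := Finset.le_sup (f := y') hj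
      omega
    · rw [Finsupp.notMem_support_iff.1 hj]; omega
  · intro z hz hzy
    apply H z
    · simp [Fintype.mem_piFinset]
      intro j
      exact hz j j.2
    · intro j hj hjm
      rw [hzy j hj (by omega), hy', if_pos hjm]

theorem GuessP.generic {ι : Type} (h : GuessP ι) (D : ι → ℕ → Set (ℕ → ℕ))
    (hO : ∀ i n, IsOpen (D i n)) (hD : ∀ i n, Dense (D i n)) (hA : ∀ i, Antitone (D i)) :
    ∃ x : ℕ → ℕ, ∀ i n, x ∈ D i n := by
  have hb := fun i n => block (hO i n) (hD i n) n
  choose y m hym hit using hb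
  let q : ι → ℕ → ℕ := fun i => partialSups (m i)
  have qm : ∀ i n, m i n ≤ q i n := fun i n => le_partialSups (m i) n
  have qmono : ∀ i, Monotone (q i) := fun i => (partialSups (m i)).monotone
  obtain ⟨H, hH⟩ := h.inf (fun i n => q i (q i n))
  let a : ℕ → ℕ := fun k => Nat.rec 0 (fun _ r => r + 1 + ∑ l ∈ Finset.range r, H l) k
  have a0 : a 0 = 0 := rfl
  have asucc : ∀ k, a (k + 1) = a k + 1 + ∑ l ∈ Finset.range (a k), H l := fun k => rfl
  clear_value a
  have amono : StrictMono a := by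
    apply strictMono_nat_of_lt_succ
    intro k
    rw [asucc]; omega
  have alt : ∀ k l, a k < a l → k < l := fun k l hkl => amono.lt_iff_lt.1 hkl
  have aH : ∀ k n, n < a (k + 1) → H n ≤ a (k + 2) := by
    intro k n hn
    have : H n ≤ ∑ l ∈ Finset.range (a (k + 1)), H l :=
      Finset.single_le_sum (f := H) (fun _ _ => Nat.zero_le _) (Finset.mem_range.2 hn)
    have e := asucc (k + 1)
    have e' : a (k + 2) = a (k + 1) + 1 + ∑ l ∈ Finset.range (a (k + 1)), H l := e
    omega
  have hkk : ∀ j, ∃ k, a k ≤ j ∧ j < a (k + 1) := by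
    intro j
    have hex : ∃ k, j < a (k + 1) := ⟨j, lt_of_lt_of_le (Nat.lt_succ_self j) (amono.id_le (j + 1))⟩
    classical
    refine ⟨Nat.find hex, ?_, Nat.find_spec hex⟩
    rcases hk : Nat.find hex with _ | k
    · rw [a0]; omega
    · exact not_lt.1 (Nat.find_min hex (m := k) (by omega))
  choose kk hk1 hk2 using hkk
  have kkuniq : ∀ j k, a k ≤ j → j < a (k + 1) → kk j = k := by
    intro j k h1 h2
    have := alt _ _ (lt_of_le_of_lt (hk1 j) h2)
    have := alt _ _ (lt_of_le_of_lt h1 (hk2 j))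
    omega
  let X : ι → Set ℕ := fun i => {k | q i (a k) ≤ a (k + 1)}
  have hX : ∀ i, (X i).Infinite := by
    intro i
    rw [Set.infinite_iff_exists_gt]
    intro N
    obtain ⟨n, hn, hHn⟩ := hH i (a (N + 1))
    have hNk : N < kk n := by
      have := alt _ _ (lt_of_le_of_lt hn (hk2 n))
      omega
    by_cases hc : q i (a (kk n)) ≤ a (kk n + 1)
    · exact ⟨kk n, hc, hNk⟩
    · refine ⟨kk n + 1, ?_, by omega⟩
      change q i (a (kk n + 1)) ≤ a (kk n + 2)
      calc q i (a (kk n + 1)) ≤ q i (q i (a (kk n))) := qmono i (not_le.1 hc).le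
        _ ≤ q i (q i n) := qmono i (qmono i (hk1 n))
        _ = H n := hHn
        _ ≤ _ := aH _ _ (hk2 n)
  obtain ⟨g, hg⟩ := h.sel X hX (fun i k => y i (a k))
  let x : ℕ → ℕ := fun j => min (g (kk j) j) (a (kk j + 1) - 1)
  refine ⟨x, fun i n => ?_⟩
  obtain ⟨k, hnk, hkX, hgk⟩ := hg i n
  have hkX' : q i (a k) ≤ a (k + 1) := hkX
  apply hA i (hnk.trans (amono.id_le k))
  have hma : m i (a k) ≤ a (k + 1) := (qm i (a k)).trans hkX'
  apply hit i (a k) x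
  · intro j hj
    have h1 := alt _ _ (lt_of_le_of_lt (hk1 j) hj)
    have h2 : a (kk j + 1) ≤ a k := amono.monotone h1
    have h3 : x j ≤ a (kk j + 1) - 1 := min_le_right _ _
    have := hk2 j
    omega
  · intro j hj hjm
    have e := kkuniq j k hj (lt_of_lt_of_le hjm hma)
    change min (g (kk j) j) (a (kk j + 1) - 1) = _
    rw [e, ← hgk]
    have := hym i (a k) j
    apply min_eq_left
    omega

theorem exists_antitone_of_meagre {A : Set (ℕ → ℕ)} (hA : IsMeagre A) :
    ∃ D : ℕ → Set (ℕ → ℕ), (∀ n, IsOpen (D n)) ∧ (∀ n, Dense (D n)) ∧ Antitone D ∧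
      ∀ x, (∀ n, x ∈ D n) → x ∉ A := by
  obtain ⟨S, hSo, hSd, hSc, hS⟩ := mem_residual_iff.1 hA
  have hc : (insert Set.univ S).Countable := hSc.insert _
  obtain ⟨E, hE⟩ := hc.exists_eq_range (Set.insert_nonempty _ _)
  have hEm : ∀ n, E n ∈ insert Set.univ S := fun n => hE ▸ Set.mem_range_self n
  have hEo : ∀ n, IsOpen (E n) := fun n => by
    rcases hEm n with h | h
    · rw [h]; exact isOpen_univ
    · exact hSo _ h
  have hEd : ∀ n, Dense (E n) := fun n => by
    rcases hEm n with h | h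
    · rw [h]; exact dense_univ
    · exact hSd _ h
  let D : ℕ → Set (ℕ → ℕ) := fun n => Nat.rec (E 0) (fun k r => r ∩ E (k + 1)) n
  have hD : ∀ n, IsOpen (D n) ∧ Dense (D n) ∧ D n ⊆ E n := by
    intro n
    induction n with
    | zero => exact ⟨hEo 0, hEd 0, subset_rfl⟩
    | succ n ih =>
      exact ⟨ih.1.inter (hEo _), ih.2.1.inter_of_isOpen_left (hEd _) ih.1,
        Set.inter_subset_right⟩
  refine ⟨D, fun n => (hD n).1, fun n => (hD n).2.1,
    antitone_nat_of_succ_le fun n => Set.inter_subset_left, fun x hx hxA => ?_⟩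
  refine hS ?_ hxA
  intro t ht
  have : t ∈ Set.range E := hE ▸ Set.mem_insert_of_mem _ ht
  obtain ⟨n, rfl⟩ := this
  exact (hD n).2.2 (hx n)

theorem meagre_avoid (c : ℕ → ℕ) : IsMeagre {g : ℕ → ℕ | ∀ n, g n ≠ c n} := by
  have e : {g : ℕ → ℕ | ∀ n, g n ≠ c n}ᶜ = ⋃ n, {g : ℕ → ℕ | g n = c n} := by
    ext g; simp
  unfold IsMeagre
  rw [e]
  apply residual_of_dense_open
  · refine isOpen_iUnion fun n => ?_
    have hcn : Continuous (fun g : ℕ → ℕ => g n) := continuous_apply n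
    exact hcn.isOpen_preimage {c n} (isOpen_discrete _)
  · intro g
    refine mem_closure_of_tendsto (f := fun n => Function.update g n (c n)) (b := atTop) ?_ ?_
    · rw [tendsto_pi_nhds]
      intro j
      refine tendsto_const_nhds.congr' ?_
      filter_upwards [eventually_gt_atTop j] with n hn
      rw [Function.update_of_ne (by omega)]
    · refine Eventually.of_forall fun n => ?_
      simp only [Set.mem_iUnion, Set.mem_ofPred_eq]
      exact ⟨n, by simp⟩


attribute [local instance] PiNat.metricSpaceNatNat

theorem edist_le_iff_agree (x y : ℕ → ℕ) (n : ℕ) :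
    edist x y ≤ ENNReal.ofReal ((1 / 2) ^ n) ↔ ∀ j < n, x j = y j := by
  rw [edist_dist, ENNReal.ofReal_le_ofReal_iff (by positivity)]
  exact (PiNat.mem_cylinder_iff_dist_le (E := fun _ => ℕ) (x := y) (y := x) (n := n)).symm

theorem guess_of_smz {ι : Type}
    (h : ∀ S : Set (ℕ → ℕ), Cardinal.mk ↥S ≤ Cardinal.mk ι → SmzMetric S) : GuessP ι := by
  classical
  intro F
  obtain ⟨U, hU, hd⟩ := h (Set.range F) Cardinal.mk_range_le (fun n => (1 / 2) ^ (n + 1))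
    (fun n => by positivity)
  refine ⟨fun n => if hn : (U n).Nonempty then hn.some n else 0, fun i => ?_⟩
  obtain ⟨n, hn⟩ := Set.mem_iUnion.1 (hU (Set.mem_range_self i))
  refine ⟨n, ?_⟩
  have hne : (U n).Nonempty := ⟨_, hn⟩
  simp only [dif_pos hne]
  exact (edist_le_iff_agree _ _ (n + 1)).1
    (Metric.edist_le_of_ediam_le hn hne.some_mem (hd n)) n (Nat.lt_succ_self n)

theorem smz_of_uncovered {S : Set (ℕ → ℕ)} (hS : ¬ SmzMetric S) :
    ∃ 𝒜 : Set (Set (ℕ → ℕ)), (∀ A ∈ 𝒜, @IsMeagre (ℕ → ℕ) Pi.topologicalSpace A) ∧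
      ⋃₀ 𝒜 = Set.univ ∧ Cardinal.mk ↥𝒜 ≤ Cardinal.mk ↥S := by
  unfold SmzMetric at hS
  push Not at hS
  obtain ⟨ε, hε, H⟩ := hS
  have hk : ∀ n, ∃ k : ℕ, ((1 : ℝ) / 2) ^ k < ε n := fun n =>
    exists_pow_lt_of_lt_one (hε n) (by norm_num)
  choose k hk using hk
  let c : (ℕ → ℕ) → ℕ → ℕ := fun x n => Encodable.encode ((List.range (k n)).map x)
  refine ⟨(fun x => {g : ℕ → ℕ | ∀ n, g n ≠ c x n}) '' S, ?_, ?_, Cardinal.mk_image_le⟩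
  · rintro _ ⟨x, -, rfl⟩
    exact meagre_avoid (c x)
  · rw [Set.eq_univ_iff_forall]
    intro g
    by_contra hg
    have hg' : ∀ x ∈ S, ∃ n, g n = c x n := by
      intro x hx
      by_contra hc
      push Not at hc
      exact hg ⟨_, ⟨x, hx, rfl⟩, hc⟩
    obtain ⟨n, hn⟩ := H (fun n => {x | g n = c x n}) (fun x hx => by
      obtain ⟨n, hn⟩ := hg' x hx
      exact Set.mem_iUnion.2 ⟨n, hn⟩)
    refine absurd hn (not_lt.2 ?_)
    refine le_trans ?_ (ENNReal.ofReal_le_ofReal (hk n).le)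
    refine Metric.ediam_le fun x hx z hz => ?_
    rw [edist_le_iff_agree]
    intro j hj
    have e : c x n = c z n := hx.symm.trans hz
    have e' := Encodable.encode_injective e
    exact List.map_inj_left.1 e' j (List.mem_range.2 hj)

theorem nonsmz_of_cover {𝒜 : Set (Set (ℕ → ℕ))}
    (hm : ∀ A ∈ 𝒜, @IsMeagre (ℕ → ℕ) Pi.topologicalSpace A) (hc : ⋃₀ 𝒜 = Set.univ) :
    ∃ S : Set (ℕ → ℕ), ¬ SmzMetric S ∧ Cardinal.mk ↥S ≤ Cardinal.mk ↥𝒜 := by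
  by_contra hcon
  push Not at hcon
  have hP : GuessP ↥𝒜 := guess_of_smz fun S hS => by
    by_contra hn
    exact absurd hS (not_le.2 (hcon S hn))
  have hD := fun A : ↥𝒜 => exists_antitone_of_meagre (hm A.1 A.2)
  choose D hO hd ha hx using hD
  obtain ⟨x, hxD⟩ := hP.generic D hO hd ha
  have : x ∈ ⋃₀ 𝒜 := hc ▸ Set.mem_univ x
  obtain ⟨A, hA, hxA⟩ := this
  exact hx ⟨A, hA⟩ x (hxD ⟨A, hA⟩) hxA

theorem sInf_eq_of_coinitial {P Q : Set Cardinal.{0}} (h1 : ∀ p ∈ P, ∃ q ∈ Q, q ≤ p)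
    (h2 : ∀ q ∈ Q, ∃ p ∈ P, p ≤ q) : sInf P = sInf Q := by
  rcases P.eq_empty_or_nonempty with rfl | hP
  · rcases Q.eq_empty_or_nonempty with rfl | ⟨q, hq⟩
    · rfl
    · obtain ⟨p, hp, -⟩ := h2 q hq
      exact absurd hp (Set.notMem_empty p)
  · have hQ : Q.Nonempty := by
      obtain ⟨p, hp⟩ := hP
      obtain ⟨q, hq, -⟩ := h1 p hp
      exact ⟨q, hq⟩
    apply le_antisymm
    · refine le_csInf hQ fun q hq => ?_
      obtain ⟨p, hp, hpq⟩ := h2 q hq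
      exact (csInf_le' hp).trans hpq
    · refine le_csInf hP fun p hp => ?_
      obtain ⟨q, hq, hqp⟩ := h1 p hp
      exact (csInf_le' hq).trans hqp


/-- `non(Smz(ℕ^ℕ)) = cov(M)` for the Baire space with the least-difference metric. -/
theorem non_smz_baire_eq_cov_meager :
    sInf {c : Cardinal | ∃ S : Set (ℕ → ℕ), ¬ SmzMetric S ∧ Cardinal.mk ↥S = c} =
      covMeager (ℕ → ℕ) := by
  unfold covMeager
  apply sInf_eq_of_coinitial
  · rintro _ ⟨S, hS, rfl⟩
    obtain ⟨𝒜, h1, h2, h3⟩ := smz_of_uncovered hS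
    exact ⟨_, ⟨𝒜, h1, h2, rfl⟩, h3⟩
  · rintro _ ⟨𝒜, h1, h2, rfl⟩
    obtain ⟨S, hS, h3⟩ := nonsmz_of_cover h1 h2
    exact ⟨_, ⟨S, hS, rfl⟩, h3⟩
end

section
/- A metric space X has strong measure zero if and only if the h-dimensional Hausdorff measure of X is zero for every gauge h. -/
open Set Filter Topology
open scoped ENNReal Pointwise

lemma smz_rank (a : ℕ → ℝ≥0∞) (ha : ∑' k, a k < 1) (hpos : ∀ k, a k ≠ 0) :
    ∃ φ : ℕ → ℕ, Function.Injective φ ∧ ∀ k, ((φ k : ℝ≥0∞) + 1) * a k < 1 := by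
  classical
  have hfin : ∀ k, {j | a k ≤ a j}.Finite := fun k =>
    ENNReal.finite_const_le_of_tsum_ne_top (ne_top_of_lt ha) (hpos k)
  let T : ℕ → Finset ℕ := fun k =>
    (hfin k).toFinset.filter (fun j => a k < a j ∨ (a j = a k ∧ j < k))
  have hT : ∀ k j, j ∈ T k ↔ (a k < a j ∨ (a j = a k ∧ j < k)) := by
    intro k j
    simp only [T, Finset.mem_filter, Set.Finite.mem_toFinset, Set.mem_setOf_eq]
    constructor
    · exact fun h => h.2
    · intro h
      refine ⟨?_, h⟩
      rcases h with h | h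
      · exact h.le
      · exact h.1.ge
  have hself : ∀ k, k ∉ T k := by
    intro k; rw [hT]; simp
  have key : ∀ k l, k ∈ T l → (T k).card < (T l).card := by
    intro k l hkl
    apply Finset.card_lt_card
    rw [Finset.ssubset_iff_of_subset]
    · exact ⟨k, hkl, hself k⟩
    · intro j hj
      rw [hT] at hj hkl ⊢
      rcases hj with hj | ⟨hj, hj'⟩ <;> rcases hkl with h | ⟨h, h'⟩
      · exact Or.inl (h.trans hj)
      · exact Or.inl (h ▸ hj)
      · exact Or.inl (hj ▸ h)
      · exact Or.inr ⟨hj.trans h, hj'.trans h'⟩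
  refine ⟨fun k => (T k).card, ?_, ?_⟩
  · intro k l hkl
    by_contra hne
    have : k ∈ T l ∨ l ∈ T k := by
      rw [hT, hT]
      rcases lt_trichotomy (a k) (a l) with h | h | h
      · exact Or.inr (Or.inl h)
      · rcases lt_or_gt_of_ne hne with h' | h'
        · exact Or.inl (Or.inr ⟨h, h'⟩)
        · exact Or.inr (Or.inr ⟨h.symm, h'⟩)
      · exact Or.inl (Or.inl h)
    simp only at hkl
    rcases this with h | h
    · exact absurd hkl (key _ _ h).ne
    · exact absurd hkl (key _ _ h).ne'
  · intro k
    refine lt_of_le_of_lt ?_ ha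
    calc (((T k).card : ℝ≥0∞) + 1) * a k = ∑ j ∈ insert k (T k), a k := by
          rw [Finset.sum_const, Finset.card_insert_of_notMem (hself k), nsmul_eq_mul]
          push_cast; rfl
      _ ≤ ∑ j ∈ insert k (T k), a j := by
          apply Finset.sum_le_sum
          intro j hj
          rcases Finset.mem_insert.1 hj with rfl | hj
          · exact le_rfl
          · rcases (hT _ _).1 hj with h | h
            · exact h.le
            · exact h.1.ge
      _ ≤ ∑' j, a j := ENNReal.sum_le_tsum _

lemma smz_gauge (ε : ℕ → ℝ) (hε : ∀ n, 0 < ε n) :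
    ∃ h : ℝ → ℝ, IsGauge h ∧ ∀ n r, ε n ≤ r → 1 / ((n : ℝ) + 1) ≤ h r := by
  have hd : ∀ m : ℕ, ∃ d : ℝ, 0 < d ∧ ∀ n < 2 ^ (m + 1), d ≤ ε n := by
    intro m
    refine ⟨(Finset.range (2 ^ (m + 1))).inf' ⟨0, by simp⟩ ε, ?_, ?_⟩
    · exact (Finset.lt_inf'_iff _).2 (fun n _ => hε n)
    · intro n hn; exact Finset.inf'_le _ (Finset.mem_range.2 hn)
  choose d hd0 hd using hd
  let f : ℕ → ℝ → ℝ := fun m r => (1 / 2 : ℝ) ^ m * min 1 (|r| / d m)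
  have hf0 : ∀ m r, 0 ≤ f m r := fun m r => by
    have := hd0 m
    positivity
  have hf1 : ∀ m r, f m r ≤ (1 / 2 : ℝ) ^ m := fun m r =>
    mul_le_of_le_one_right (by positivity) (min_le_left _ _)
  have hs : ∀ r, Summable (fun m => f m r) := fun r =>
    Summable.of_nonneg_of_le (fun m => hf0 m r) (fun m => hf1 m r) summable_geometric_two
  have hle : ∀ m r, f m r ≤ ∑' m, f m r := fun m r =>
    (hs r).le_tsum m (fun j _ => hf0 j r)
  have hcont : Continuous (fun r => ∑' m, f m r) := by
    refine continuous_tsum (u := fun m => (1 / 2 : ℝ) ^ m) ?_ summable_geometric_two ?_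
    · intro m; fun_prop
    · intro m r
      rw [Real.norm_of_nonneg (hf0 m r)]
      exact hf1 m r
  refine ⟨fun r => ∑' m, f m r, ⟨?_, ?_, ?_, ?_, ?_⟩, ?_⟩
  · exact fun r _ => tsum_nonneg (fun m => hf0 m r)
  · intro r hr s hs' hrs
    refine (hs r).tsum_le_tsum (fun m => ?_) (hs s)
    have := hd0 m
    have h1 : |r| ≤ |s| := abs_le_abs_of_nonneg hr hrs
    simp only [f]
    gcongr
  · exact fun r _ => hcont.continuousWithinAt
  · simp [f]
  · intro r hr
    refine lt_of_lt_of_le ?_ (hle 0 r)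
    have := hd0 0
    have : 0 < |r| := abs_pos.2 hr.ne'
    simp only [f]
    positivity
  · intro n r hr
    let m := Nat.log 2 (n + 1)
    have h1 : 2 ^ m ≤ n + 1 := Nat.pow_log_le_self 2 (by omega)
    have h2 : n + 1 < 2 ^ (m + 1) := Nat.lt_pow_succ_log_self (by norm_num) _
    refine le_trans ?_ (hle m r)
    have h3 : d m ≤ |r| := (hd m n (by omega)).trans (hr.trans (le_abs_self r))
    have h4 : 1 ≤ |r| / d m := (one_le_div (hd0 m)).2 h3
    simp only [f]
    rw [min_eq_left h4, mul_one, one_div_pow]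
    apply one_div_le_one_div_of_le (by positivity)
    exact_mod_cast h1

/-- Besicovitch: a metric space is Smz iff `H^h(X) = 0` for every gauge `h`. -/
theorem smz_iff_hausdorffH_zero {X : Type*} [MetricSpace X] :
    SmzMetric (Set.univ : Set X) ↔
      ∀ h : ℝ → ℝ, IsGauge h → hausdorffH h (Set.univ : Set X) = 0 := by
  constructor
  · intro hX h hh
    unfold hausdorffH
    simp only [ENNReal.iSup_eq_zero]
    intro δ hδ
    rw [← nonpos_iff_eq_zero]
    refine le_of_forall_pos_le_add ?_
    intro η hη
    rw [zero_add]
    obtain ⟨c, hc0, hc⟩ := ENNReal.exists_pos_sum_of_countable hη.ne' ℕ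
    have hex : ∀ n, ∃ e : ℝ, 0 < e ∧ e ≤ δ ∧ h e ≤ c n := by
      intro n
      have ht : Tendsto h (𝓝[>] 0) (𝓝 0) := by
        have := hh.rightCont 0 le_rfl
        rwa [ContinuousWithinAt, hh.zero] at this
      have h1 : ∀ᶠ e in 𝓝[>] (0 : ℝ), h e < c n :=
        ht.eventually_lt_const (by exact_mod_cast hc0 n)
      have h2 : ∀ᶠ e in 𝓝[>] (0 : ℝ), e ∈ Set.Ioc 0 δ := Ioc_mem_nhdsGT hδ
      obtain ⟨e, he1, he2⟩ := (h1.and h2).exists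
      exact ⟨e, he2.1, he2.2, he1.le⟩
    choose e he0 heδ hec using hex
    obtain ⟨U, hU, hUe⟩ := hX e he0
    refine iInf_le_of_le U (iInf_le_of_le hU (iInf_le_of_le
      (fun n => (hUe n).trans (ENNReal.ofReal_le_ofReal (heδ n))) ?_))
    refine le_trans (ENNReal.tsum_le_tsum fun n => ?_) hc.le
    rw [← ENNReal.ofReal_coe_nnreal]
    apply ENNReal.ofReal_le_ofReal
    refine le_trans (hh.mono ENNReal.toReal_nonneg (he0 n).le ?_) (hec n)
    exact ENNReal.toReal_le_of_le_ofReal (he0 n).le (hUe n)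
  · intro H ε hε
    obtain ⟨h, hh, hhε⟩ := smz_gauge ε hε
    have h0 := H h hh
    unfold hausdorffH at h0
    simp only [ENNReal.iSup_eq_zero] at h0
    have h1 := h0 1 one_pos
    have h2 : (0 : ℝ≥0∞) < 2⁻¹ := by simp
    rw [← h1] at h2
    simp only [iInf_lt_iff] at h2
    obtain ⟨U, hU, hU1, hsum⟩ := h2
    obtain ⟨c, hc0, hc⟩ := ENNReal.exists_pos_sum_of_countable
      (show (2⁻¹ : ℝ≥0∞) ≠ 0 by simp) ℕ
    obtain ⟨φ, hφ, hφ1⟩ := smz_rank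
      (fun k => ENNReal.ofReal (h (EMetric.diam (U k)).toReal) + c k)
      (by
        rw [ENNReal.tsum_add, ← ENNReal.inv_two_add_inv_two]
        exact ENNReal.add_lt_add hsum hc)
      (fun k => by
        have := (hc0 k).ne'
        simp [this])
    refine ⟨Function.extend φ U (fun _ => ∅), ?_, ?_⟩
    · intro x hx
      obtain ⟨k, hk⟩ := Set.mem_iUnion.1 (hU hx)
      refine Set.mem_iUnion.2 ⟨φ k, ?_⟩
      rwa [hφ.extend_apply]
    · intro n
      by_cases hn : ∃ k, φ k = n
      · obtain ⟨k, rfl⟩ := hn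
        rw [hφ.extend_apply]
        have hfin : EMetric.diam (U k) ≠ ⊤ :=
          ne_top_of_le_ne_top ENNReal.ofReal_ne_top (hU1 k)
        rw [ENNReal.le_ofReal_iff_toReal_le hfin (hε _).le]
        by_contra hlt
        have h3 := hhε (φ k) _ (not_le.1 hlt).le
        refine absurd (hφ1 k) (not_lt.2 ?_)
        calc (1 : ℝ≥0∞) = ENNReal.ofReal (((φ k : ℝ) + 1) * (1 / ((φ k : ℝ) + 1))) := by
              rw [mul_one_div_cancel (by positivity), ENNReal.ofReal_one]
          _ = ((φ k : ℝ≥0∞) + 1) * ENNReal.ofReal (1 / ((φ k : ℝ) + 1)) := by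
              rw [ENNReal.ofReal_mul (by positivity),
                ENNReal.ofReal_add (by positivity) (by positivity)]
              simp
          _ ≤ _ := by
              gcongr
              exact (ENNReal.ofReal_le_ofReal h3).trans le_self_add
      · rw [Function.extend_apply' _ _ _ hn]
        exact (Metric.ediam_empty (X := X)).le.trans zero_le
end

section
/- Let X be a metric space with metric d. The following are equivalent: (i) X has strong measure zero; (ii) the Hausdorff dimension of f(X) is 0 for every metric space Y and every uniformly continuous mapping f : X → Y; (iii) the Hausdorff dimension of (X, ρ) is 0 for every metric ρ on X that is uniformly equivalent to d. -/
open Set Filter Topology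
open scoped ENNReal Pointwise

/-- A positive summable family with sum `< 1` can be sorted. -/
theorem smz_sort (b : ℕ → ℝ≥0∞) (hb : ∀ n, b n ≠ 0) (hs : ∑' n, b n < 1) :
    ∃ σ : ℕ → ℕ, Function.Injective σ ∧ ∀ n, b n < ((σ n : ℝ≥0∞) + 1)⁻¹ := by
  classical
  have hfin : ∀ n, {m | b n ≤ b m}.Finite := fun n =>
    ENNReal.finite_const_le_of_tsum_ne_top (hs.trans ENNReal.one_lt_top).ne (hb n)
  let S : ℕ → Set ℕ := fun n => {m | b n < b m ∨ (b m = b n ∧ m < n)}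
  have hSsub : ∀ n, S n ⊆ {m | b n ≤ b m} := by
    rintro n m (h | ⟨h, -⟩)
    · exact h.le
    · exact h.ge
  have hSfin : ∀ n, (S n).Finite := fun n => (hfin n).subset (hSsub n)
  have hnS : ∀ n, n ∉ S n := by
    rintro n (h | ⟨-, h⟩)
    · exact lt_irrefl _ h
    · exact lt_irrefl _ h
  have hlt : ∀ m n, m ∈ S n → (S m).ncard < (S n).ncard := by
    intro m n hmn
    apply Set.ncard_lt_ncard _ (hSfin n)
    refine ⟨?_, fun h => hnS m (h hmn)⟩
    intro k hk
    rcases hk with hk | ⟨hk, hk'⟩ <;> rcases hmn with hmn | ⟨hmn, hmn'⟩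
    · exact Or.inl (hmn.trans hk)
    · exact Or.inl (hmn ▸ hk)
    · exact Or.inl (hk ▸ hmn)
    · exact Or.inr ⟨hk.trans hmn, hk'.trans hmn'⟩
  refine ⟨fun n => (S n).ncard, ?_, ?_⟩
  · intro m n hmn
    by_contra hne
    rcases lt_trichotomy (b m) (b n) with h | h | h
    · exact (hlt n m (Or.inl h)).ne hmn.symm
    · rcases lt_or_gt_of_ne hne with h' | h'
      · exact (hlt m n (Or.inr ⟨h, h'⟩)).ne hmn
      · exact (hlt n m (Or.inr ⟨h.symm, h'⟩)).ne hmn.symm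
    · exact (hlt m n (Or.inl h)).ne hmn
  · intro n
    have h1 : (((S n).ncard : ℝ≥0∞) + 1) * b n < 1 := by
      refine lt_of_le_of_lt ?_ hs
      have hc : (insert n (hSfin n).toFinset).card = (S n).ncard + 1 := by
        rw [Finset.card_insert_of_notMem (by simpa using hnS n),
          Set.ncard_eq_toFinset_card _ (hSfin n)]
      calc (((S n).ncard : ℝ≥0∞) + 1) * b n
          = ∑ _m ∈ insert n (hSfin n).toFinset, b n := by
            rw [Finset.sum_const, hc, nsmul_eq_mul]; push_cast; rfl
        _ ≤ ∑ m ∈ insert n (hSfin n).toFinset, b m := by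
            apply Finset.sum_le_sum
            intro m hm
            rcases Finset.mem_insert.1 hm with h | h
            · rw [h]
            · exact hSsub n (by simpa using h)
        _ ≤ _ := ENNReal.sum_le_tsum _
    rw [ENNReal.lt_inv_iff_lt_inv, ← one_div, ENNReal.lt_div_iff_mul_lt] <;> simp_all

/-- Zero Hausdorff dimension gives covers with small sum of diameters. -/
theorem smz_cover_of_dimH {Y : Type*} [EMetricSpace Y] (s : Set Y) (h : dimH s = 0)
    (c : ℝ≥0∞) (hc : 0 < c) :
    ∃ V : ℕ → Set Y, s ⊆ (⋃ n, V n) ∧ ∑' n, Metric.ediam (V n) < c := by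
  borelize Y
  have h0 : MeasureTheory.Measure.hausdorffMeasure ((1 : NNReal) : ℝ) s = 0 :=
    hausdorffMeasure_of_dimH_lt (by rw [h]; simp)
  rw [MeasureTheory.Measure.hausdorffMeasure_apply] at h0
  have h1 := (ENNReal.iSup_eq_zero.1 (ENNReal.iSup_eq_zero.1 h0 1)) one_pos
  have h2 := h1.trans_lt hc
  simp only [iInf_lt_iff] at h2
  obtain ⟨V, hV, -, hsum⟩ := h2
  refine ⟨V, hV, lt_of_le_of_lt (ENNReal.tsum_le_tsum fun n => ?_) hsum⟩
  rcases (V n).eq_empty_or_nonempty with h | h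
  · simp [h]
  · simp [h]

theorem smz_extract {X Y : Type*} [PseudoEMetricSpace X] [EMetricSpace Y] (f : X → Y)
    (h : dimH (range f) = 0) (ε : ℕ → ℝ)
    (hf : ∀ (j : ℕ) x y, edist (f x) (f y) < ((j : ℝ≥0∞) + 1)⁻¹ → edist x y ≤ ENNReal.ofReal (ε j)) :
    ∃ U : ℕ → Set X, univ ⊆ (⋃ n, U n) ∧ ∀ n, Metric.ediam (U n) ≤ ENNReal.ofReal (ε n) := by
  obtain ⟨V, hV, hs⟩ := smz_cover_of_dimH _ h 1 one_pos
  obtain ⟨δ, hδ, hδs⟩ := ENNReal.exists_pos_sum_of_countable (tsub_pos_of_lt hs).ne' ℕ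
  obtain ⟨σ, hσ, hb⟩ := smz_sort (fun n => Metric.ediam (V n) + δ n)
    (fun n => by have := hδ n; simp; intro _; exact this.ne')
    (by rw [ENNReal.tsum_add]; exact lt_tsub_iff_left.1 hδs)
  refine ⟨Function.extend σ (fun n => f ⁻¹' (V n)) (fun _ => ∅), ?_, ?_⟩
  · intro x _
    obtain ⟨n, hn⟩ := mem_iUnion.1 (hV (mem_range_self x))
    refine mem_iUnion.2 ⟨σ n, ?_⟩
    rw [hσ.extend_apply]
    exact hn
  · intro j
    by_cases hj : ∃ n, σ n = j
    · obtain ⟨n, rfl⟩ := hj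
      rw [hσ.extend_apply]
      refine Metric.ediam_le fun x hx y hy => hf _ _ _ ?_
      have hxy : edist (f x) (f y) ≤ Metric.ediam (V n) := Metric.edist_le_ediam_of_mem hx hy
      exact hxy.trans_lt (le_self_add.trans_lt (hb n))
    · rw [Function.extend_apply' _ _ _ hj]
      simp

theorem smz_dimH_zero {X Y : Type*} [PseudoEMetricSpace X] [EMetricSpace Y] (f : X → Y)
    (hf : UniformContinuous f) (h : SmzMetric (univ : Set X)) : dimH (range f) = 0 := by
  borelize Y
  rw [EMetric.uniformContinuous_iff] at hf
  have key : ∀ (d : NNReal), 0 < d →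
      MeasureTheory.Measure.hausdorffMeasure (d : ℝ) (range f) = 0 := by
    intro d hd
    have hd' : (0 : ℝ) < d := hd
    rw [← nonpos_iff_eq_zero]
    refine le_of_forall_gt_imp_ge_of_dense fun c hc => ?_
    rw [MeasureTheory.Measure.hausdorffMeasure_apply]
    refine iSup₂_le fun r hr => ?_
    obtain ⟨δ, hδ, hδs⟩ := ENNReal.exists_pos_sum_of_countable hc.ne' ℕ
    have hη : ∀ n, 0 < min r ((δ n : ℝ≥0∞) ^ (1 / (d : ℝ))) := fun n =>
      lt_min hr (ENNReal.rpow_pos (by exact_mod_cast hδ n) ENNReal.coe_ne_top)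
    choose e he0 he using fun n => hf _ (hη n)
    have : ∀ n, ∃ t : ℝ, 0 < t ∧ ENNReal.ofReal t < e n := by
      intro n
      obtain ⟨q, hq0, hq⟩ := ENNReal.lt_iff_exists_nnreal_btwn.1 (he0 n)
      exact ⟨q, by exact_mod_cast hq0, by simpa using hq⟩
    choose t ht0 ht using this
    obtain ⟨U, hU, hUd⟩ := h t ht0
    have hdiam : ∀ n, Metric.ediam (f '' U n) ≤ min r ((δ n : ℝ≥0∞) ^ (1 / (d : ℝ))) := by
      intro n
      refine Metric.ediam_le ?_
      rintro _ ⟨x, hx, rfl⟩ _ ⟨y, hy, rfl⟩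
      refine (he n ?_).le
      exact ((Metric.edist_le_ediam_of_mem hx hy).trans (hUd n)).trans_lt (ht n)
    refine (iInf₂_le (fun n => f '' U n) ?_).trans ((iInf_le _ ?_).trans ?_)
    · rintro _ ⟨x, rfl⟩
      obtain ⟨n, hn⟩ := mem_iUnion.1 (hU (mem_univ x))
      exact mem_iUnion.2 ⟨n, x, hn, rfl⟩
    · exact fun n => (hdiam n).trans (min_le_left _ _)
    · refine le_trans (ENNReal.tsum_le_tsum fun n => ?_) hδs.le
      refine iSup_le fun _ => ?_
      calc _ ≤ ((δ n : ℝ≥0∞) ^ (1 / (d : ℝ))) ^ (d : ℝ) :=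
            ENNReal.rpow_le_rpow ((hdiam n).trans (min_le_right _ _)) hd'.le
        _ = δ n := by
            rw [← ENNReal.rpow_mul, one_div, inv_mul_cancel₀ hd'.ne', ENNReal.rpow_one]
  rw [← nonpos_iff_eq_zero]
  refine dimH_le fun d hd => ?_
  by_contra hcon
  have : 0 < d := pos_iff_ne_zero.2 (by simpa using hcon)
  rw [key d this] at hd
  exact ENNReal.zero_ne_top hd

/-- The gauge used for remetrization. -/
noncomputable def smzGauge (ε : ℕ → ℝ) (r : ℝ) : ℝ :=
  ⨆ k : ℕ, min (1 / ((k : ℝ) + 1)) (r / ε k)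

theorem smzGauge_bdd (ε : ℕ → ℝ) (r : ℝ) :
    BddAbove (range fun k : ℕ => min (1 / ((k : ℝ) + 1)) (r / ε k)) := by
  refine ⟨1, ?_⟩
  rintro _ ⟨k, rfl⟩
  refine (min_le_left _ _).trans ?_
  rw [div_le_one (by positivity)]
  simp

theorem smzGauge_ge (ε : ℕ → ℝ) (r : ℝ) (k : ℕ) :
    min (1 / ((k : ℝ) + 1)) (r / ε k) ≤ smzGauge ε r :=
  le_ciSup (smzGauge_bdd ε r) k

theorem smzGauge_zero (ε : ℕ → ℝ) : smzGauge ε 0 = 0 := by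
  have : ∀ k : ℕ, min (1 / ((k : ℝ) + 1)) (0 / ε k) = 0 := fun k => by
    rw [zero_div]; exact min_eq_right (by positivity)
  simp only [smzGauge, this, ciSup_const]

theorem smzGauge_lt {ε : ℕ → ℝ} (hε : ∀ n, 0 < ε n) {r : ℝ} {j : ℕ}
    (h : smzGauge ε r < 1 / ((j : ℝ) + 1)) : r < ε j := by
  have h1 := (smzGauge_ge ε r j).trans_lt h
  rcases min_lt_iff.1 h1 with h2 | h2
  · exact absurd h2 (lt_irrefl _)
  · have : r / ε j < 1 := h2.trans_le (by rw [div_le_one (by positivity)]; simp)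
    exact (div_lt_one (hε j)).1 this

theorem smzGauge_pos {ε : ℕ → ℝ} (hε : ∀ n, 0 < ε n) {r : ℝ} (hr : 0 < r) :
    0 < smzGauge ε r :=
  lt_of_lt_of_le (lt_min (by positivity) (div_pos hr (hε 0))) (smzGauge_ge ε r 0)

theorem smzGauge_le_add {ε : ℕ → ℝ} (hε : ∀ n, 0 < ε n) {r s t : ℝ} (hs : 0 ≤ s) (ht : 0 ≤ t)
    (h : r ≤ s + t) : smzGauge ε r ≤ smzGauge ε s + smzGauge ε t := by
  refine ciSup_le fun k => ?_
  refine le_trans ?_ (add_le_add (smzGauge_ge ε s k) (smzGauge_ge ε t k))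
  have h1 : r / ε k ≤ s / ε k + t / ε k := by
    rw [← add_div]; exact div_le_div_of_nonneg_right h (hε k).le
  have h2 : 0 ≤ s / ε k := div_nonneg hs (hε k).le
  have h3 : 0 ≤ t / ε k := div_nonneg ht (hε k).le
  have h4 : (0 : ℝ) < 1 / ((k : ℝ) + 1) := by positivity
  rcases min_cases (1 / ((k : ℝ) + 1)) (s / ε k) with h | h <;>
  rcases min_cases (1 / ((k : ℝ) + 1)) (t / ε k) with h' | h' <;>
  rcases min_cases (1 / ((k : ℝ) + 1)) (r / ε k) with h'' | h'' <;> linarith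

theorem smzGauge_small {ε : ℕ → ℝ} (hε : ∀ n, 0 < ε n) {c : ℝ} (hc : 0 < c) :
    ∃ δ > 0, ∀ r < δ, smzGauge ε r < c := by
  obtain ⟨N, hN⟩ := exists_nat_one_div_lt (half_pos hc)
  have : ∃ δ > 0, ∀ k ≤ N, δ ≤ (c / 2) * ε k := by
    clear hN
    induction N with
    | zero => exact ⟨(c / 2) * ε 0, mul_pos (half_pos hc) (hε 0), by simp⟩
    | succ N ih =>
      obtain ⟨δ, hδ, h⟩ := ih
      refine ⟨min δ ((c / 2) * ε (N + 1)), lt_min hδ (mul_pos (half_pos hc) (hε _)), ?_⟩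
      intro k hk
      rcases Nat.le_succ_iff.1 hk with h' | h'
      · exact (min_le_left _ _).trans (h k h')
      · rw [h']; exact min_le_right _ _
  obtain ⟨δ, hδ, h⟩ := this
  refine ⟨δ, hδ, fun r hr => lt_of_le_of_lt (ciSup_le fun k => ?_) (half_lt_self hc)⟩
  rcases le_total k N with hk | hk
  · refine (min_le_right _ _).trans ?_
    rw [div_le_iff₀ (hε k)]
    exact hr.le.trans (h k hk)
  · refine (min_le_left _ _).trans (le_trans ?_ hN.le)
    exact one_div_le_one_div_of_le (by positivity) (by gcongr)

/-- Uniformly equivalent remetrization. -/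
theorem smz_remetrize {X : Type*} [m : MetricSpace X] (ε : ℕ → ℝ) (hε : ∀ n, 0 < ε n) :
    ∃ m' : MetricSpace X, m'.toUniformSpace = m.toUniformSpace ∧
      ∀ (j : ℕ) (x y : X), m'.toDist.dist x y < 1 / ((j : ℝ) + 1) → m.toDist.dist x y < ε j := by
  refine ⟨{ dist := fun x y => smzGauge ε (dist x y)
            dist_self := fun x => by simp [smzGauge_zero]
            dist_comm := fun x y => by simp [dist_comm]
            dist_triangle := fun x y z =>
              smzGauge_le_add hε dist_nonneg dist_nonneg (dist_triangle x y z)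
            eq_of_dist_eq_zero := fun {x y} h => by
              by_contra hne
              exact (smzGauge_pos hε (dist_pos.2 hne)).ne' h
            toUniformSpace := m.toUniformSpace
            uniformity_dist := ?_ }, rfl, fun j x y h => smzGauge_lt hε h⟩
  rw [Metric.uniformity_basis_dist.eq_biInf]
  apply le_antisymm
  · refine le_iInf₂ fun c hc => ?_
    obtain ⟨δ, hδ, h⟩ := smzGauge_small hε hc
    refine (iInf₂_le δ hδ).trans (principal_mono.2 ?_)
    rintro ⟨x, y⟩ hxy
    exact h _ hxy
  · refine le_iInf₂ fun c hc => ?_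
    refine (iInf₂_le _ (smzGauge_pos hε hc)).trans (principal_mono.2 ?_)
    rintro ⟨x, y⟩ hxy
    by_contra hcon
    have h1 : c ≤ dist x y := not_lt.1 hcon
    have h2 : smzGauge ε c ≤ smzGauge ε (dist x y) + smzGauge ε 0 :=
      smzGauge_le_add hε dist_nonneg le_rfl (by simpa using h1)
    rw [smzGauge_zero, add_zero] at h2
    exact absurd hxy (not_lt.2 h2)

theorem smz_edist_conv {Z : Type*} [MetricSpace Z] (x y : Z) (j : ℕ)
    (h : edist x y < ((j : ℝ≥0∞) + 1)⁻¹) : dist x y < 1 / ((j : ℝ) + 1) := by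
  have h1 : ((j : ℝ≥0∞) + 1)⁻¹ = ENNReal.ofReal (1 / ((j : ℝ) + 1)) := by
    rw [one_div, ENNReal.ofReal_inv_of_pos (by positivity), ENNReal.ofReal_add (by positivity) one_pos.le]
    simp
  rw [h1, edist_dist] at h
  exact (ENNReal.ofReal_lt_ofReal_iff (by positivity)).1 h

theorem smz_extract_dist {X Y : Type*} [MetricSpace X] [MetricSpace Y] (f : X → Y)
    (h : dimH (range f) = 0) (ε : ℕ → ℝ)
    (hf : ∀ (j : ℕ) x y, dist (f x) (f y) < 1 / ((j : ℝ) + 1) → dist x y < ε j) :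
    ∃ U : ℕ → Set X, univ ⊆ (⋃ n, U n) ∧ ∀ n, Metric.ediam (U n) ≤ ENNReal.ofReal (ε n) := by
  refine smz_extract f h ε fun j x y hxy => ?_
  rw [edist_dist]
  exact ENNReal.ofReal_le_ofReal (hf j x y (smz_edist_conv _ _ j hxy)).le

theorem smz_dimH_zero' {X Y : Type*} [MetricSpace X] [MetricSpace Y] (f : X → Y)
    (hf : UniformContinuous f) (h : SmzMetric (univ : Set X)) : dimH (range f) = 0 :=
  smz_dimH_zero f hf h

/-- Hypothesis (ii) forces separability. -/
theorem smz_separable {X : Type u} [MetricSpace X]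
    (H : ∀ (Y : Type v) [MetricSpace Y] (f : X → Y), UniformContinuous f →
        dimH (Set.range f) = 0) : SecondCountableTopology X := by
  refine Metric.secondCountable_of_almost_dense_set fun ε hε => ?_
  obtain ⟨S, hS⟩ := zorn_subset {s : Set X | s.Pairwise fun x y => ε < dist x y} (by
    intro c hc hchain
    refine ⟨⋃₀ c, ?_, fun s hs => subset_sUnion_of_mem hs⟩
    exact (Set.pairwise_sUnion hchain.directedOn).2 fun s hs => hc hs)
  refine ⟨S, ?_, ?_⟩
  · by_contra hunc
    have hcard : Cardinal.lift.{u} (Cardinal.aleph 1 : Cardinal.{0}) ≤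
        Cardinal.lift.{0} (Cardinal.mk S) := by
      rw [Cardinal.lift_aleph]
      simp only [Ordinal.lift_one, Cardinal.lift_id']
      rw [← Cardinal.succ_aleph0, Order.succ_le_iff]
      by_contra hle
      exact hunc (Cardinal.mk_le_aleph0_iff.1 (not_lt.1 hle))
    rw [← Cardinal.mk_out (Cardinal.aleph 1 : Cardinal.{0}), Cardinal.lift_mk_le'] at hcard
    obtain ⟨e⟩ := hcard
    set I : Type := (Cardinal.aleph 1 : Cardinal.{0}).out with hI
    have hIunc : ¬ Countable I := by
      rw [← Cardinal.mk_le_aleph0_iff, Cardinal.mk_out]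
      exact not_le.2 Cardinal.aleph0_lt_aleph_one
    let g : X → lp (fun _ : I => ℝ) ∞ := fun x =>
      ⟨fun i => min 1 (dist x (e i : X)), by
        apply memℓp_infty
        refine ⟨1, ?_⟩
        rintro _ ⟨i, rfl⟩
        simp only [Real.norm_eq_abs]
        rw [abs_of_nonneg (le_min one_pos.le dist_nonneg)]
        exact min_le_left _ _⟩
    have hg : LipschitzWith 1 g := by
      rw [LipschitzWith.coordinate]
      intro i
      exact (LipschitzWith.dist_left (e i : X)).const_min 1
    have hup : Isometry (ULift.up : lp (fun _ : I => ℝ) ∞ → ULift.{v} (lp (fun _ : I => ℝ) ∞)) :=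
      fun _ _ => rfl
    have h0 := H _ _ (hup.uniformContinuous.comp hg.uniformContinuous)
    rw [range_comp, hup.dimH_image] at h0
    have hc : 0 < ENNReal.ofReal (min 1 ε) := ENNReal.ofReal_pos.2 (lt_min one_pos hε)
    obtain ⟨V, hV, hVs⟩ := smz_cover_of_dimH _ h0 _ hc
    have hmem : ∀ i : I, ∃ n, g (e i) ∈ V n := fun i => mem_iUnion.1 (hV (mem_range_self _))
    choose k hk using hmem
    have hkinj : Function.Injective k := by
      intro i j hij
      by_contra hne
      have h1 : edist (g (e i)) (g (e j)) < ENNReal.ofReal (min 1 ε) :=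
        ((Metric.edist_le_ediam_of_mem (hk i) (hij ▸ hk j)).trans
          (ENNReal.le_tsum (f := fun n => Metric.ediam (V n)) (k i))).trans_lt hVs
      rw [edist_dist, ENNReal.ofReal_lt_ofReal_iff (lt_min one_pos hε), dist_eq_norm] at h1
      have h2 := lp.norm_apply_le_norm ENNReal.top_ne_zero (g (e i) - g (e j)) j
      have h3 : (g (e i) - g (e j)) j = min 1 (dist (e i : X) (e j)) := by
        change min 1 (dist (e i : X) (e j)) - min 1 (dist (e j : X) (e j)) = _
        simp
      rw [h3, Real.norm_eq_abs, abs_of_nonneg (le_min one_pos.le dist_nonneg)] at h2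
      have h4 : ε < dist (e i : X) (e j) := hS.prop (e i).2 (e j).2
        (fun h => hne (e.injective (Subtype.ext h)))
      have h5 : min 1 ε ≤ min 1 (dist (e i : X) (e j)) := min_le_min le_rfl h4.le
      linarith
    exact hIunc hkinj.countable
  · intro x
    by_contra! hcon
    have hx : x ∉ S := fun h => by
      have := hcon x h
      rw [dist_self] at this
      exact lt_asymm hε this
    have : insert x S ⊆ S := hS.le_of_ge (by
      refine Set.pairwise_insert.2 ⟨hS.prop, fun y hy _ => ⟨hcon y hy, ?_⟩⟩
      rw [dist_comm]
      exact hcon y hy) (subset_insert x S)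
    exact hx (this (mem_insert x S))

/-- `X` is Smz iff every uniformly continuous image has Hausdorff dimension `0`
iff every uniformly equivalent metric on `X` has Hausdorff dimension `0`. -/
theorem smz_iff_dimH_images_zero_iff_dimH_equiv_metrics_zero
    {X : Type u} [m : MetricSpace X] :
    (SmzMetric (Set.univ : Set X) ↔
      ∀ (Y : Type v) [MetricSpace Y] (f : X → Y), UniformContinuous f →
        dimH (Set.range f) = 0) ∧
    (SmzMetric (Set.univ : Set X) ↔
      ∀ m' : MetricSpace X, m'.toUniformSpace = m.toUniformSpace →
        @dimH X (@MetricSpace.toEMetricSpace X m') (Set.univ : Set X) = 0) := by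
  refine ⟨⟨fun h Y _ f hf => smz_dimH_zero f hf h, fun H ε hε => ?_⟩,
    ⟨fun h m' hm' => ?_, fun H ε hε => ?_⟩⟩
  · have hsc : SecondCountableTopology X := smz_separable H
    obtain ⟨m', hm', hd⟩ := smz_remetrize (X := X) ε hε
    have hsep : @TopologicalSpace.SeparableSpace X m'.toUniformSpace.toTopologicalSpace := by
      rw [hm']; infer_instance
    obtain ⟨g, hg⟩ := @KuratowskiEmbedding.exists_isometric_embedding X m' hsep
    have hgu : @UniformContinuous X _ m.toUniformSpace _ g := by
      have := @Isometry.uniformContinuous X _ m'.toPseudoMetricSpace.toPseudoEMetricSpace _ g hg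
      exact hm' ▸ this
    have hup : Isometry (ULift.up :
        lp (fun _ : ℕ => ℝ) ∞ → ULift.{v} (lp (fun _ : ℕ => ℝ) ∞)) := fun _ _ => rfl
    have h0 := H _ _ (@UniformContinuous.comp X _ _ m.toUniformSpace _ _ _ _
      hup.uniformContinuous hgu)
    rw [range_comp, hup.dimH_image] at h0
    refine @smz_extract_dist X _ m _ g h0 ε fun j x y hxy => hd j x y ?_
    rwa [← @Isometry.dist_eq X _ m'.toPseudoMetricSpace _ g hg x y]
  · have hid : @UniformContinuous X X m.toUniformSpace m'.toUniformSpace id := by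
      rw [hm']; exact @uniformContinuous_id X m.toUniformSpace
    have := @smz_dimH_zero' X X m m' id hid h
    rwa [range_id] at this
  · obtain ⟨m', hm', hd⟩ := smz_remetrize (X := X) ε hε
    have h0 := H m' hm'
    rw [← range_id] at h0
    exact @smz_extract_dist X X m m' id h0 ε hd
end

section
/- Let X be a metric space. The following are equivalent: (i) X has strong measure zero; (ii) H^h(X × Y) = 0 for every gauge h and every compact metric space Y with H^h(Y) = 0, where X × Y carries the maximum metric; (iii) H^1(X × E) = 0 for every set E ⊆ 2^ℕ that is contained in a σ-compact subset of 2^ℕ of H^1-measure zero, where 2^ℕ carries the metric of least difference and X × E the maximum metric. -/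
open Set Filter Topology
open scoped ENNReal Pointwise

attribute [local instance] PiNat.metricSpace

theorem hnull_iff {X : Type*} [PseudoEMetricSpace X] {h : ℝ → ℝ} {E : Set X} :
    hausdorffH h E = 0 ↔ ∀ δ : ℝ, 0 < δ → ∀ ε : ℝ≥0∞, ε ≠ 0 →
      ∃ U : ℕ → Set X, E ⊆ (⋃ n, U n) ∧ (∀ n, Metric.ediam (U n) ≤ ENNReal.ofReal δ) ∧
        ∑' n, ENNReal.ofReal (h (Metric.ediam (U n)).toReal) < ε := by
  unfold hausdorffH
  simp only [ENNReal.iSup_eq_zero]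
  refine forall_congr' fun δ => forall_congr' fun hδ => ?_
  constructor
  · intro H ε hε
    have : (⨅ (U : ℕ → Set X) (_ : E ⊆ ⋃ n, U n)
      (_ : ∀ n, EMetric.diam (U n) ≤ ENNReal.ofReal δ),
      ∑' n, ENNReal.ofReal (h (EMetric.diam (U n)).toReal)) < ε := by
      rw [H]; exact pos_iff_ne_zero.2 hε
    simp only [iInf_lt_iff] at this
    obtain ⟨U, h1, h2, h3⟩ := this
    exact ⟨U, h1, h2, h3⟩
  · intro H
    by_contra hne
    obtain ⟨U, h1, h2, h3⟩ := H _ hne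
    exact absurd h3 (not_lt.2 (iInf_le_of_le U (iInf_le_of_le h1 (iInf_le_of_le h2 le_rfl))))

theorem hnull_of_countable {X : Type*} [PseudoEMetricSpace X] {h : ℝ → ℝ} {E : Set X}
    (h0 : h 0 = 0)
    (H : ∀ δ : ℝ, 0 < δ → ∀ ε : ℝ≥0∞, ε ≠ 0 →
      ∃ (ι : Type) (_ : Countable ι) (U : ι → Set X), E ⊆ (⋃ n, U n) ∧
        (∀ n, Metric.ediam (U n) ≤ ENNReal.ofReal δ) ∧
        ∑' n, ENNReal.ofReal (h (Metric.ediam (U n)).toReal) < ε) :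
    hausdorffH h E = 0 := by
  refine hnull_iff.2 fun δ hδ ε hε => ?_
  obtain ⟨ι, _, U, h1, h2, h3⟩ := H δ hδ ε hε
  obtain ⟨_⟩ := nonempty_encodable ι
  refine ⟨fun i => ⋃ b ∈ Encodable.decode₂ ι i, U b, ?_, ?_, ?_⟩
  · rw [Encodable.iUnion_decode₂]; exact h1
  · intro n
    refine Encodable.iUnion_decode₂_cases
      (C := fun s => Metric.ediam s ≤ ENNReal.ofReal δ) (by simp) (fun b => h2 b)
  · rw [tsum_iUnion_decode₂ (fun s : Set X => ENNReal.ofReal (h (Metric.ediam s).toReal))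
      (by simp [h0])]
    exact h3

theorem hnull_mono {X : Type*} [PseudoEMetricSpace X] {h : ℝ → ℝ} {E F : Set X}
    (hEF : E ⊆ F) (H : hausdorffH h F = 0) : hausdorffH h E = 0 := by
  rw [hnull_iff] at *
  intro δ hδ ε hε
  obtain ⟨U, h1, h2⟩ := H δ hδ ε hε
  exact ⟨U, hEF.trans h1, h2⟩

theorem hnull_iUnion {X : Type*} [PseudoEMetricSpace X] {h : ℝ → ℝ} {E : ℕ → Set X}
    (h0 : h 0 = 0) (H : ∀ n, hausdorffH h (E n) = 0) : hausdorffH h (⋃ n, E n) = 0 := by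
  refine hnull_of_countable h0 fun δ hδ ε hε => ?_
  obtain ⟨e, he, hes⟩ := ENNReal.exists_pos_sum_of_countable' hε ℕ
  choose U h1 h2 h3 using fun n => hnull_iff.1 (H n) δ hδ (e n) (he n).ne'
  refine ⟨ℕ × ℕ, inferInstance, fun p => U p.1 p.2, ?_, fun p => h2 _ _, ?_⟩
  · intro x hx
    obtain ⟨n, hn⟩ := mem_iUnion.1 hx
    obtain ⟨m, hm⟩ := mem_iUnion.1 (h1 n hn)
    exact mem_iUnion.2 ⟨(n, m), hm⟩
  · rw [ENNReal.tsum_prod (f := fun n m => ENNReal.ofReal (h (Metric.ediam (U n m)).toReal))]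
    exact (ENNReal.tsum_le_tsum fun n => (h3 n).le).trans_lt hes

theorem hnull_image {X Y : Type*} [PseudoEMetricSpace X] [PseudoEMetricSpace Y] {h : ℝ → ℝ}
    (hm : MonotoneOn h (Set.Ici 0)) {E : Set X} (f : X → Y)
    (hf : ∀ x ∈ E, ∀ y ∈ E, edist (f x) (f y) ≤ edist x y)
    (H : hausdorffH h E = 0) : hausdorffH h (f '' E) = 0 := by
  rw [hnull_iff] at *
  intro δ hδ ε hε
  obtain ⟨U, h1, h2, h3⟩ := H δ hδ ε hε
  have key : ∀ n, Metric.ediam (f '' (U n ∩ E)) ≤ Metric.ediam (U n) := by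
    intro n
    refine Metric.ediam_le ?_
    rintro _ ⟨x, hx, rfl⟩ _ ⟨y, hy, rfl⟩
    exact (hf x hx.2 y hy.2).trans (Metric.edist_le_ediam_of_mem hx.1 hy.1)
  refine ⟨fun n => f '' (U n ∩ E), ?_, fun n => (key n).trans (h2 n), ?_⟩
  · rintro _ ⟨x, hx, rfl⟩
    obtain ⟨n, hn⟩ := mem_iUnion.1 (h1 hx)
    exact mem_iUnion.2 ⟨n, x, ⟨hn, hx⟩, rfl⟩
  · refine (ENNReal.tsum_le_tsum fun n => ENNReal.ofReal_le_ofReal ?_).trans_lt h3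
    exact hm ENNReal.toReal_nonneg ENNReal.toReal_nonneg
      (ENNReal.toReal_mono (ne_top_of_le_ne_top ENNReal.ofReal_ne_top (h2 n)) (key n))

theorem compact_cover {Y : Type*} [PseudoEMetricSpace Y] {h : ℝ → ℝ} (hh : IsGauge h)
    {K : Set Y} (hK : IsCompact K) (H : hausdorffH h K = 0) (δ : ℝ) (hδ : 0 < δ)
    (ε : ℝ≥0∞) (hε : ε ≠ 0) :
    ∃ (t : Finset ℕ) (V : ℕ → Set Y) (r : ℕ → ℝ), K ⊆ (⋃ k ∈ t, V k) ∧
      (∀ k, Metric.ediam (V k) ≤ ENNReal.ofReal (r k)) ∧ (∀ k, 0 < r k) ∧ (∀ k, r k ≤ δ) ∧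
      ∑ k ∈ t, ENNReal.ofReal (h (r k)) < ε := by
  have hε2 : ε / 2 ≠ 0 := by simpa using hε
  obtain ⟨U, h1, h2, h3⟩ := hnull_iff.1 H (δ/2) (by positivity) (ε/2) hε2
  obtain ⟨e, he, hes⟩ := ENNReal.exists_pos_sum_of_countable hε2 ℕ
  have hd : ∀ n, (Metric.ediam (U n)).toReal ≤ δ / 2 := fun n =>
    ENNReal.toReal_le_of_le_ofReal (by positivity) (h2 n)
  have hfin : ∀ n, Metric.ediam (U n) ≠ ⊤ := fun n =>
    ne_top_of_le_ne_top ENNReal.ofReal_ne_top (h2 n)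
  have hs : ∀ n, ∃ s : ℝ, 0 < s ∧ s ≤ δ/2 ∧
      h ((Metric.ediam (U n)).toReal + s) ≤ h (Metric.ediam (U n)).toReal + e n := by
    intro n
    set d := (Metric.ediam (U n)).toReal
    have hc := hh.rightCont d ENNReal.toReal_nonneg
    have h4 : ∀ᶠ r in 𝓝[>] d, h r < h d + e n :=
      hc.eventually (gt_mem_nhds (by have := he n; simpa using this))
    have h5 : ∀ᶠ r in 𝓝[>] d, r ∈ Set.Ioo d (d + δ/2) :=
      Ioo_mem_nhdsGT (by linarith)
    obtain ⟨r, hr1, hr2⟩ := (h4.and h5).exists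
    refine ⟨r - d, by linarith [hr2.1], by linarith [hr2.2], ?_⟩
    rw [add_sub_cancel]; exact hr1.le
  choose s hs0 hs1 hs2 using hs
  have hopen : ∀ n, IsOpen (Metric.thickening (s n / 2) (U n)) := fun n => Metric.isOpen_thickening
  obtain ⟨t, ht⟩ := hK.elim_finite_subcover _ hopen (h1.trans (iUnion_mono fun n =>
    Metric.self_subset_thickening (half_pos (hs0 n)) _))
  refine ⟨t, _, fun n => (Metric.ediam (U n)).toReal + s n, ht, ?_, ?_, ?_, ?_⟩
  · intro n
    obtain ⟨c, hc⟩ : ∃ c : NNReal, (c : ℝ) = s n / 2 := ⟨⟨s n / 2, (half_pos (hs0 n)).le⟩, rfl⟩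
    have := Metric.ediam_thickening_le (s := U n) c
    rw [hc] at this
    refine this.trans ?_
    rw [ENNReal.ofReal_add ENNReal.toReal_nonneg (hs0 n).le, ENNReal.ofReal_toReal (hfin n)]
    gcongr
    have h6 : s n = 2 * (c : ℝ) := by rw [hc]; ring
    rw [h6, ENNReal.ofReal_mul (by norm_num)]
    simp
  · intro n
    have := hs0 n
    have : 0 ≤ (Metric.ediam (U n)).toReal := ENNReal.toReal_nonneg
    dsimp only; linarith [hs0 n]
  · intro n
    have := hd n
    have := hs1 n
    dsimp only; linarith
  · calc _ ≤ ∑' n, ENNReal.ofReal (h ((Metric.ediam (U n)).toReal + s n)) := ENNReal.sum_le_tsum _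
      _ ≤ ∑' n, (ENNReal.ofReal (h (Metric.ediam (U n)).toReal) + e n) := by
        refine ENNReal.tsum_le_tsum fun n => ?_
        refine (ENNReal.ofReal_le_ofReal (hs2 n)).trans ?_
        refine ENNReal.ofReal_add_le.trans ?_
        simp
      _ = _ := ENNReal.tsum_add
      _ < ε / 2 + ε / 2 := ENNReal.add_lt_add h3 hes
      _ = ε := ENNReal.add_halves ε

theorem ediam_prod_le' {X Y : Type*} [PseudoEMetricSpace X] [PseudoEMetricSpace Y]
    {S : Set X} {T : Set Y} {c : ℝ≥0∞} (hS : Metric.ediam S ≤ c) (hT : Metric.ediam T ≤ c) :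
    Metric.ediam (S ×ˢ T) ≤ c := by
  refine Metric.ediam_le ?_
  rintro ⟨x, y⟩ ⟨hx, hy⟩ ⟨x', y'⟩ ⟨hx', hy'⟩
  rw [Prod.edist_eq]
  exact max_le ((Metric.edist_le_ediam_of_mem hx hx').trans hS)
    ((Metric.edist_le_ediam_of_mem hy hy').trans hT)

theorem smz_prod_null {X Y : Type*} [PseudoEMetricSpace X] [PseudoEMetricSpace Y]
    (hX : SmzMetric (Set.univ : Set X)) {h : ℝ → ℝ} (hh : IsGauge h)
    {K : Set Y} (hK : IsCompact K) (H : hausdorffH h K = 0) :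
    hausdorffH h ((Set.univ : Set X) ×ˢ K) = 0 := by
  refine hnull_of_countable hh.zero fun δ hδ ε hε => ?_
  obtain ⟨e, he, hes⟩ := ENNReal.exists_pos_sum_of_countable' hε ℕ
  choose t V r h1 h2 h3 h4 h5 using fun n => compact_cover hh hK H δ hδ (e n) (he n).ne'
  have hρ : ∀ n, ∃ ρ : ℝ, 0 < ρ ∧ ∀ k ∈ t n, ρ ≤ r n k := by
    intro n
    have : ∀ᶠ ρ in 𝓝[>] (0:ℝ), ∀ k ∈ t n, ρ ≤ r n k := by
      rw [Filter.eventually_all_finset]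
      intro k _
      exact Filter.mem_of_superset (Ioo_mem_nhdsGT (h3 n k)) fun x hx => hx.2.le
    obtain ⟨ρ, hρ, hρ'⟩ := (this.and self_mem_nhdsWithin).exists
    exact ⟨ρ, hρ', hρ⟩
  choose ρ hρ0 hρ1 using hρ
  obtain ⟨W, hW, hWd⟩ := hX ρ hρ0
  have hdiam : ∀ n, ∀ k ∈ t n, Metric.ediam (W n ×ˢ V n k) ≤ ENNReal.ofReal (r n k) := by
    intro n k hk
    exact ediam_prod_le' ((hWd n).trans (ENNReal.ofReal_le_ofReal (hρ1 n k hk))) (h2 n k)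
  refine ⟨Σ n, t n, inferInstance, fun p => W p.1 ×ˢ V p.1 p.2, ?_, ?_, ?_⟩
  · rintro ⟨x, y⟩ ⟨-, hy⟩
    obtain ⟨n, hn⟩ := mem_iUnion.1 (hW (mem_univ x))
    obtain ⟨k, hk, hky⟩ := mem_iUnion₂.1 (h1 n hy)
    exact mem_iUnion.2 ⟨⟨n, ⟨k, hk⟩⟩, hn, hky⟩
  · rintro ⟨n, k, hk⟩
    exact (hdiam n k hk).trans (ENNReal.ofReal_le_ofReal (h4 n k))
  · rw [ENNReal.tsum_sigma (f := fun n (k : t n) =>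
      ENNReal.ofReal (h (Metric.ediam (W n ×ˢ V n k)).toReal))]
    refine (ENNReal.tsum_le_tsum fun n => ?_).trans_lt hes
    rw [tsum_fintype]
    refine le_trans ?_ (h5 n).le
    rw [← Finset.sum_coe_sort (t n)]
    refine Finset.sum_le_sum fun k _ => ENNReal.ofReal_le_ofReal ?_
    exact hh.mono ENNReal.toReal_nonneg (h3 n k).le
      (ENNReal.toReal_le_of_le_ofReal (h3 n k).le (hdiam n k k.2))

theorem isGauge_id : IsGauge (fun r : ℝ => r) where
  nonneg := fun r hr => hr
  mono := fun a _ b _ hab => hab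
  rightCont := fun r _ => continuous_id.continuousWithinAt
  zero := rfl
  pos := fun r hr => hr

/-- The compact set of sequences vanishing at the places marked by `p`. -/
def vanishSet (p : ℕ → Prop) : Set (ℕ → Bool) := {x | ∀ n, p n → x n = false}

theorem isCompact_vanishSet (p : ℕ → Prop) : IsCompact (vanishSet p) := by
  refine IsClosed.isCompact ?_
  have : vanishSet p = ⋂ n, ⋂ (_ : p n), {x : ℕ → Bool | x n = false} := by
    ext x; simp [vanishSet]
  rw [this]
  exact isClosed_iInter fun n => isClosed_iInter fun _ =>
    isClosed_eq (continuous_apply n) continuous_const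

theorem edist_le_of_agree {x y : ℕ → Bool} {n : ℕ} (H : ∀ i < n, x i = y i) :
    edist x y ≤ ENNReal.ofReal ((1/2 : ℝ)^n) := by
  rw [edist_dist]
  refine ENNReal.ofReal_le_ofReal ?_
  exact PiNat.mem_cylinder_iff_dist_le.1 (PiNat.mem_cylinder_iff.2 H)

theorem agree_of_edist_le {x y : ℕ → Bool} {n : ℕ}
    (H : edist x y ≤ ENNReal.ofReal ((1/2 : ℝ)^n)) : ∀ i < n, x i = y i := by
  rw [edist_dist, ENNReal.ofReal_le_ofReal_iff (by positivity)] at H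
  exact PiNat.mem_cylinder_iff.1 (PiNat.mem_cylinder_iff_dist_le.2 H)

open Classical in
theorem card_split (p : ℕ → Prop) (n : ℕ) :
    ((Finset.range n).filter p).card + ((Finset.range n).filter (fun k => ¬ p k)).card = n := by
  rw [Finset.card_filter_add_card_filter_not, Finset.card_range]

open Classical in
theorem vanishSet_null (p : ℕ → Prop)
    (hp : ∀ m, ∃ n0, ∀ n, n0 ≤ n → m ≤ ((Finset.range n).filter p).card) :
    hausdorffH (fun r => r) (vanishSet p) = 0 := by
  refine hnull_of_countable rfl fun δ hδ ε hε => ?_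
  obtain ⟨n1, hn1⟩ := exists_pow_lt_of_lt_one hδ (show (1/2 : ℝ) < 1 by norm_num)
  obtain ⟨m, hm⟩ := ENNReal.exists_inv_two_pow_lt hε
  obtain ⟨n0, hn0⟩ := hp m
  set n := max n0 n1
  have hmn := hn0 n (le_max_left _ _)
  have hn : (1/2 : ℝ)^n ≤ δ :=
    (pow_le_pow_of_le_one (by norm_num) (by norm_num) (le_max_right _ _)).trans hn1.le
  set B := (Finset.range n).filter (fun k => ¬ p k)
  have hB := card_split p n
  let U : (B → Bool) → Set (ℕ → Bool) := fun s => {x | x ∈ vanishSet p ∧ ∀ k : B, x k = s k}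
  have hU : ∀ s, Metric.ediam (U s) ≤ ENNReal.ofReal ((1/2 : ℝ)^n) := by
    intro s
    refine Metric.ediam_le fun x hx y hy => edist_le_of_agree fun i hi => ?_
    by_cases hpi : p i
    · rw [hx.1 i hpi, hy.1 i hpi]
    · have hi' : i ∈ B := by simp [B, hi, hpi]
      rw [hx.2 ⟨i, hi'⟩, hy.2 ⟨i, hi'⟩]
  refine ⟨B → Bool, inferInstance, U, ?_, ?_, ?_⟩
  · intro x hx
    exact mem_iUnion.2 ⟨fun k => x k, hx, fun k => rfl⟩
  · exact fun s => (hU s).trans (ENNReal.ofReal_le_ofReal hn)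
  · refine lt_of_le_of_lt ?_ hm
    rw [tsum_fintype]
    calc ∑ s, ENNReal.ofReal (Metric.ediam (U s)).toReal
        ≤ ∑ s : B → Bool, ENNReal.ofReal ((1/2 : ℝ)^n) :=
          Finset.sum_le_sum fun s _ => ENNReal.ofReal_toReal_le.trans (hU s)
      _ = ENNReal.ofReal (2^B.card * (1/2 : ℝ)^n) := by
          rw [Finset.sum_const, Finset.card_univ, Fintype.card_fun, Fintype.card_bool,
            Fintype.card_coe, nsmul_eq_mul, ENNReal.ofReal_mul (by positivity)]
          congr 1
          rw [ENNReal.ofReal_pow (by norm_num)]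
          simp
      _ ≤ ENNReal.ofReal ((1/2 : ℝ)^m) := by
          refine ENNReal.ofReal_le_ofReal ?_
          rw [← hB, pow_add]
          have h1 : (2:ℝ)^B.card * (1/2)^B.card = 1 := by rw [← mul_pow]; norm_num
          have h2 : (1/2 : ℝ)^((Finset.range n).filter p).card ≤ (1/2)^m :=
            pow_le_pow_of_le_one (by norm_num) (by norm_num) hmn
          calc _ = (1/2 : ℝ)^((Finset.range n).filter p).card * ((2:ℝ)^B.card * (1/2)^B.card) := by
                ring
            _ ≤ _ := by rw [h1, mul_one]; exact h2
      _ = (2⁻¹)^m := by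
          rw [ENNReal.ofReal_pow (by norm_num)]
          congr 1
          rw [one_div, ENNReal.ofReal_inv_of_pos (by norm_num)]
          simp

/-- Fair coin measure. -/
noncomputable def coin : MeasureTheory.Measure Bool := (PMF.uniformOfFintype Bool).toMeasure

instance : MeasureTheory.IsProbabilityMeasure coin := by unfold coin; infer_instance

theorem coin_singleton (b : Bool) : coin {b} = 2⁻¹ := by
  unfold coin
  rw [PMF.toMeasure_apply_singleton _ _ (measurableSet_singleton b)]
  simp

/-- Selection of a section with few large pieces. -/
theorem exists_section (B : ℕ → Finset ℕ) (w : ℕ → ℕ → Bool) (c : ℕ → ℝ≥0∞)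
    (hc : ∑' i, c i * 2⁻¹ ^ (B i).card < 1) :
    ∃ z : ℕ → Bool, ∑' i, (Set.pi (B i : Set ℕ) (fun k => {w i k})).indicator
      (fun _ => c i) z < 1 := by
  let μ := MeasureTheory.Measure.infinitePi (fun _ : ℕ => coin)
  have hms : ∀ i, MeasurableSet (Set.pi (B i : Set ℕ) (fun k => ({w i k} : Set Bool))) :=
    fun i => MeasurableSet.pi (Finset.countable_toSet _) fun k _ => measurableSet_singleton _
  have hint : ∫⁻ z, ∑' i, (Set.pi (B i : Set ℕ) (fun k => {w i k})).indicator
      (fun _ => c i) z ∂μ < 1 := by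
    rw [MeasureTheory.lintegral_tsum
      (fun i => (measurable_const.indicator (hms i)).aemeasurable)]
    convert hc using 3 with i
    rw [MeasureTheory.lintegral_indicator_const (hms i)]
    congr 1
    rw [MeasureTheory.Measure.infinitePi_pi _ (fun k _ => measurableSet_singleton _)]
    simp [coin_singleton]
  by_contra! hcon
  refine absurd hint (not_lt.2 ?_)
  calc (1 : ℝ≥0∞) = ∫⁻ z, 1 ∂μ := by simp
    _ ≤ _ := MeasureTheory.lintegral_mono fun z => hcon z

open Classical in
/-- Main covering argument. -/
theorem cover_of_null {X : Type*} [PseudoEMetricSpace X] (p : ℕ → Prop)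
    (H : hausdorffH (fun r => r) ((Set.univ : Set X) ×ˢ vanishSet p) = 0) :
    ∃ (V : ℕ → Set X) (I : Set ℕ) (n : ℕ → ℕ), (∀ x, ∃ i ∈ I, x ∈ V i) ∧
      (∀ i, Metric.ediam (V i) ≤ ENNReal.ofReal ((1/2 : ℝ)^(n i))) ∧
      ∑' i : I, (2⁻¹ : ℝ≥0∞) ^ ((Finset.range (n i)).filter p).card < 1 := by
  have h4 : (4⁻¹ : ℝ≥0∞) ≠ 0 := by simp
  obtain ⟨U, h1, h2, h3⟩ := hnull_iff.1 H 1 one_pos 4⁻¹ h4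
  obtain ⟨e, he, hes⟩ := ENNReal.exists_pos_sum_of_countable h4 ℕ
  have hfin : ∀ i, Metric.ediam (U i) ≠ ⊤ := fun n =>
    ne_top_of_le_ne_top ENNReal.ofReal_ne_top (h2 n)
  set d : ℕ → ℝ := fun i => (Metric.ediam (U i)).toReal with hd
  set t : ℕ → ℝ := fun i => d i + e i with ht
  have ht0 : ∀ i, 0 < t i := fun i =>
    add_pos_of_nonneg_of_pos ENNReal.toReal_nonneg (by exact_mod_cast he i)
  have htsum : ∑' i, ENNReal.ofReal (t i) < 2⁻¹ := by
    have h5 : ∀ i, ENNReal.ofReal (t i) = ENNReal.ofReal (d i) + e i := by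
      intro i
      show ENNReal.ofReal (d i + e i) = _
      rw [ENNReal.ofReal_add (show 0 ≤ d i from ENNReal.toReal_nonneg) (NNReal.coe_nonneg (e i))]; simp
    simp_rw [h5]
    rw [ENNReal.tsum_add]
    refine (ENNReal.add_lt_add h3 hes).trans_eq ?_
    have : (4 : ℝ≥0∞) = 2 * 2 := by norm_num
    rw [this, ENNReal.mul_inv (by simp) (by simp), ← two_mul, ← mul_assoc,
      ENNReal.mul_inv_cancel (by simp) (by simp), one_mul]
  have ht1 : ∀ i, t i ≤ 1 := by
    intro i
    have := (ENNReal.le_tsum (f := fun i => ENNReal.ofReal (t i)) i).trans htsum.le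
    have h6 : ENNReal.ofReal (t i) ≤ 1 := this.trans (by simp)
    simpa using h6
  choose n hn1 hn2 using fun i => exists_nat_pow_near_of_lt_one (ht0 i) (ht1 i)
    (show (0:ℝ) < 1/2 by norm_num) (show (1/2:ℝ) < 1 by norm_num)
  have hUd : ∀ i, Metric.ediam (U i) ≤ ENNReal.ofReal ((1/2 : ℝ)^(n i)) := by
    intro i
    rw [← ENNReal.ofReal_toReal (hfin i)]
    refine ENNReal.ofReal_le_ofReal (le_trans ?_ (hn2 i))
    exact le_add_of_nonneg_right (NNReal.coe_nonneg (e i))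
  have hhalf : ∀ k : ℕ, ENNReal.ofReal ((1/2 : ℝ)^k) = 2⁻¹ ^ k := by
    intro k
    rw [ENNReal.ofReal_pow (by norm_num), one_div, ENNReal.ofReal_inv_of_pos (by norm_num)]
    simp
  have hw : ∀ i, ∃ w : ℕ → Bool, ∀ q ∈ U i, ∀ k < n i, q.2 k = w k := by
    intro i
    by_cases hne : (U i).Nonempty
    · obtain ⟨q0, hq0⟩ := hne
      refine ⟨q0.2, fun q hq => agree_of_edist_le ?_⟩
      refine le_trans ?_ (hUd i)
      refine le_trans ?_ (Metric.edist_le_ediam_of_mem hq hq0)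
      rw [Prod.edist_eq]; exact le_max_right _ _
    · exact ⟨fun _ => false, fun q hq => absurd ⟨q, hq⟩ hne⟩
  choose w hw using hw
  obtain ⟨z, hz⟩ := exists_section (fun i => (Finset.range (n i)).filter (fun k => ¬ p k)) w
    (fun i => 2⁻¹ ^ ((Finset.range (n i)).filter p).card) (by
      calc _ = ∑' i, (2⁻¹ : ℝ≥0∞) ^ (n i) := by
            refine tsum_congr fun i => ?_
            rw [← pow_add, card_split]
        _ ≤ ∑' i, 2 * ENNReal.ofReal (t i) := by
            refine ENNReal.tsum_le_tsum fun i => ?_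
            rw [← hhalf]
            have : (2 : ℝ≥0∞) = ENNReal.ofReal 2 := by simp
            rw [this, ← ENNReal.ofReal_mul (by norm_num)]
            refine ENNReal.ofReal_le_ofReal ?_
            have := hn1 i
            rw [pow_succ] at this
            linarith
        _ = 2 * ∑' i, ENNReal.ofReal (t i) := ENNReal.tsum_mul_left
        _ < 2 * 2⁻¹ := ENNReal.mul_lt_mul_right (by simp) (by simp) htsum
        _ = 1 := ENNReal.mul_inv_cancel (by simp) (by simp))
  set y : ℕ → Bool := fun k => if p k then false else z k with hy
  have hyC : y ∈ vanishSet p := fun k hk => by simp [hy, hk]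
  refine ⟨fun i => Prod.fst '' U i, {i | ∃ x, (x, y) ∈ U i}, n, ?_, ?_, ?_⟩
  · intro x
    obtain ⟨i, hi⟩ := mem_iUnion.1 (h1 (show (x, y) ∈ univ ×ˢ vanishSet p from ⟨mem_univ _, hyC⟩))
    exact ⟨i, ⟨x, hi⟩, (x, y), hi, rfl⟩
  · intro i
    refine le_trans (Metric.ediam_le ?_) (hUd i)
    rintro _ ⟨a, ha, rfl⟩ _ ⟨b, hb, rfl⟩
    refine le_trans ?_ (Metric.edist_le_ediam_of_mem ha hb)
    rw [Prod.edist_eq]; exact le_max_left _ _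
  · refine lt_of_le_of_lt ?_ hz
    rw [tsum_subtype (f := fun i => (2⁻¹ : ℝ≥0∞) ^ ((Finset.range (n i)).filter p).card)]
    refine ENNReal.tsum_le_tsum fun i => ?_
    refine Set.indicator_apply_le' ?_ (fun _ => zero_le)
    rintro ⟨x, hx⟩
    rw [Set.indicator_of_mem]
    intro k hk
    simp only [Finset.coe_filter, Finset.mem_range, mem_ofPred_eq] at hk
    have := hw i _ hx k hk.1
    simpa [hy, hk.2] using this

open Classical in
theorem smz_of_compact {X : Type*} [PseudoEMetricSpace X]
    (H : ∀ p : ℕ → Prop, hausdorffH (fun r => r) (vanishSet p) = 0 →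
      hausdorffH (fun r => r) ((Set.univ : Set X) ×ˢ vanishSet p) = 0) :
    SmzMetric (Set.univ : Set X) := by
  intro ε hε
  obtain ⟨α, hα, hαε⟩ := Filter.extraction_forall_of_eventually
    (P := fun m k => ∀ j ∈ Finset.range (2^(m+2)), (1/2 : ℝ)^k ≤ ε j) (by
      intro m
      rw [Filter.eventually_all_finset]
      intro j _
      have := tendsto_pow_atTop_nhds_zero_of_lt_one (show (0:ℝ) ≤ 1/2 by norm_num)
        (show (1/2:ℝ) < 1 by norm_num)
      exact (this.eventually (gt_mem_nhds (hε j))).mono fun k hk => hk.le)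
  set p : ℕ → Prop := fun k => k ∈ Set.range α with hp
  set a : ℕ → ℕ := fun n => ((Finset.range n).filter p).card with ha
  have ha1 : ∀ m n, α m < n → m + 1 ≤ a n := by
    intro m n hmn
    have hsub : (Finset.range (m+1)).image α ⊆ (Finset.range n).filter p := by
      intro k hk
      obtain ⟨i, hi, rfl⟩ := Finset.mem_image.1 hk
      have : α i ≤ α m := hα.monotone (Nat.lt_succ_iff.1 (Finset.mem_range.1 hi))
      simp only [Finset.mem_filter, Finset.mem_range]
      exact ⟨by omega, i, rfl⟩
    have := Finset.card_le_card hsub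
    rwa [Finset.card_image_of_injective _ hα.injective, Finset.card_range] at this
  have ha2 : ∀ m n, n ≤ α m → a n ≤ m := by
    intro m n hmn
    have hsub : (Finset.range n).filter p ⊆ (Finset.range m).image α := by
      intro k hk
      simp only [Finset.mem_filter, Finset.mem_range] at hk
      obtain ⟨hk, i, rfl⟩ := hk
      exact Finset.mem_image.2 ⟨i, Finset.mem_range.2 (hα.lt_iff_lt.1 (by omega)), rfl⟩
    exact (Finset.card_le_card hsub).trans (Finset.card_image_le.trans (by simp))
  have hnull := vanishSet_null p (fun m => ⟨α m + 1, fun n hn => by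
    have := ha1 m n (by omega)
    simp only [ha] at this
    omega⟩)
  obtain ⟨V, I, n, hV, hVd, hsum⟩ := cover_of_null p (H p hnull)
  -- few indices at each level
  have hlev : ∀ m, ∀ F : Finset I, (∀ i ∈ F, a (n i) = m) → F.card < 2^m := by
    intro m F hF
    have h1 : ∑ i ∈ F, (2⁻¹ : ℝ≥0∞) ^ (a (n i)) < 1 := (ENNReal.sum_le_tsum F).trans_lt hsum
    rw [Finset.sum_congr rfl (fun i hi => by rw [hF i hi]), Finset.sum_const, nsmul_eq_mul,
      ← ENNReal.inv_pow, ← div_eq_mul_inv] at h1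
    have h2 := (ENNReal.div_lt_iff (Or.inl (by simp)) (Or.inl (by simp))).1 h1
    rw [one_mul] at h2
    exact_mod_cast h2
  have hfinite : ∀ m, {i : I | a (n i) = m}.Finite := by
    intro m
    by_contra hinf
    obtain ⟨F, hF, hFc⟩ := Set.Infinite.exists_subset_card_eq hinf (2^m)
    exact absurd (hlev m F fun i hi => hF hi) (by omega)
  -- an injective numbering
  have hnum : ∀ m, ∃ f : I → ℕ, (∀ i : I, a (n i) = m → f i < 2^m) ∧
      ∀ i j : I, a (n i) = m → a (n j) = m → f i = f j → i = j := by
    intro m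
    set F := (hfinite m).toFinset with hF
    have hmem : ∀ i : I, i ∈ F ↔ a (n i) = m := by simp [hF]
    have hcard := hlev m F fun i hi => (hmem i).1 hi
    refine ⟨fun i => if hi : i ∈ F then F.equivFin ⟨i, hi⟩ else 0, ?_, ?_⟩
    · intro i hi
      have hi' := (hmem i).2 hi
      simp only [hi', dif_pos]
      exact (Fin.is_lt _).trans hcard
    · intro i j hi hj hij
      have hi' := (hmem i).2 hi
      have hj' := (hmem j).2 hj
      simp only [hi', hj', dif_pos] at hij
      have := F.equivFin.injective (Fin.ext hij)
      simpa using this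
  choose f hf1 hf2 using hnum
  set g : I → ℕ := fun i => 2^(a (n i)) + f (a (n i)) i with hg
  have hglt : ∀ i : I, g i < 2^(a (n i) + 1) := by
    intro i
    have := hf1 _ i rfl
    simp only [hg, pow_succ]; omega
  have hgle : ∀ i : I, 2^(a (n i)) ≤ g i := fun i => by simp [hg]
  have hinj : Function.Injective g := by
    intro i j hij
    have hl : a (n i) = a (n j) := by
      have h1 : 2^(a (n i)) < 2^(a (n j) + 1) := (hgle i).trans_lt (hij ▸ hglt j)
      have h2 : 2^(a (n j)) < 2^(a (n i) + 1) := (hgle j).trans_lt (hij ▸ hglt i)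
      have h1 := (Nat.pow_lt_pow_iff_right (by norm_num)).1 h1
      have h2 := (Nat.pow_lt_pow_iff_right (by norm_num)).1 h2
      omega
    refine hf2 (a (n i)) i j rfl hl.symm ?_
    have : g i = g j := hij
    simp only [hg] at this
    rw [← hl] at this
    omega
  have hgε : ∀ i : I, (1/2 : ℝ)^(n i) ≤ ε (g i) := by
    intro i
    have hpos : a (n i) ≠ 0 := by
      intro h0
      have := hf1 _ i rfl
      have := hlev 0 {i} (by simpa using h0)
      simp at this
    obtain ⟨m, hm⟩ := Nat.exists_eq_succ_of_ne_zero hpos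
    have hαm : α m < n i := by
      by_contra hcon
      have := ha2 m (n i) (by omega)
      omega
    refine le_trans ?_ (hαε m (g i) ?_)
    · exact pow_le_pow_of_le_one (by norm_num) (by norm_num) hαm.le
    · have := hglt i
      rw [hm] at this
      exact Finset.mem_range.2 this
  refine ⟨fun j => ⋃ (i : I) (_ : g i = j), V i, ?_, ?_⟩
  · intro x _
    obtain ⟨i, hi, hx⟩ := hV x
    exact mem_iUnion.2 ⟨g ⟨i, hi⟩, mem_iUnion₂.2 ⟨⟨i, hi⟩, rfl, hx⟩⟩
  · intro j
    by_cases hj : ∃ i, g i = j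
    · obtain ⟨i, rfl⟩ := hj
      have : (⋃ (i' : I) (_ : g i' = g i), V i') ⊆ V i := by
        refine iUnion₂_subset fun i' hi' => ?_
        rw [hinj hi']
      exact (Metric.ediam_mono this).trans
        ((hVd i).trans (ENNReal.ofReal_le_ofReal (hgε i)))
    · have : (⋃ (i : I) (_ : g i = j), V i) = ∅ := by
        simp only [iUnion_eq_empty]
        intro i hi
        exact absurd ⟨i, hi⟩ hj
      show Metric.ediam (⋃ (i : I) (_ : g i = j), V i) ≤ _
      rw [this]; simp

/-- characterization of Smz via products: `X` is Smz iff `H^h(X × Y) = 0` for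
every gauge `h` and compact metric `Y` with `H^h(Y) = 0`, iff `H^1(X × E) = 0` for every
`E ⊆ 2^ℕ` contained in a σ-compact `H^1`-null set. -/
theorem smz_iff_product_hausdorff_null {X : Type u} [MetricSpace X] :
    (SmzMetric (Set.univ : Set X) ↔
      ∀ (h : ℝ → ℝ), IsGauge h →
        ∀ (Y : Type v) [MetricSpace Y] [CompactSpace Y],
          hausdorffH h (Set.univ : Set Y) = 0 →
            hausdorffH h (Set.univ : Set (X × Y)) = 0) ∧
    (SmzMetric (Set.univ : Set X) ↔
      ∀ E : Set (ℕ → Bool),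
        (∃ K : Set (ℕ → Bool), E ⊆ K ∧ IsSigmaCompact K ∧
          hausdorffH (fun r => r) K = 0) →
        hausdorffH (fun r => r) ((Set.univ : Set X) ×ˢ E) = 0) := by
  refine ⟨⟨?_, ?_⟩, ?_, ?_⟩
  · intro hX h hh Y _ _ hY
    have := smz_prod_null hX hh isCompact_univ hY
    rwa [Set.univ_prod_univ] at this
  · intro H
    refine smz_of_compact fun p hp => ?_
    have hc : CompactSpace (vanishSet p) := isCompact_iff_compactSpace.1 (isCompact_vanishSet p)
    classical
    let x0 : vanishSet p := ⟨fun _ => false, fun _ _ => rfl⟩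
    let r : (ℕ → Bool) → ULift.{v} (vanishSet p) := fun x =>
      if hx : x ∈ vanishSet p then ⟨⟨x, hx⟩⟩ else ⟨x0⟩
    have hY : hausdorffH (fun r => r) (Set.univ : Set (ULift.{v} (vanishSet p))) = 0 := by
      have := hnull_image isGauge_id.mono r (fun x hx y hy => by
        simp only [r, hx, hy, dif_pos]; exact le_rfl) hp
      refine hnull_mono ?_ this
      rintro ⟨⟨x, hx⟩⟩ -
      exact ⟨x, hx, by simp [r, hx]⟩
    have h2 := H (fun r => r) isGauge_id (ULift.{v} (vanishSet p)) hY
    have h3 := hnull_image isGauge_id.mono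
      (fun q : X × ULift.{v} (vanishSet p) => (q.1, (q.2.down : ℕ → Bool)))
      (fun x _ y _ => le_rfl) h2
    refine hnull_mono ?_ h3
    rintro ⟨x, y⟩ ⟨-, hy⟩
    exact ⟨(x, ⟨⟨y, hy⟩⟩), mem_univ _, rfl⟩
  · rintro hX E ⟨K, hEK, ⟨L, hL, hLK⟩, hK⟩
    have h1 : ∀ n, hausdorffH (fun r => r) ((Set.univ : Set X) ×ˢ L n) = 0 := fun n =>
      smz_prod_null hX isGauge_id (hL n)
        (hnull_mono (by rw [← hLK]; exact subset_iUnion L n) hK)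
    refine hnull_mono ?_ (hnull_iUnion rfl h1)
    rintro ⟨x, y⟩ ⟨-, hy⟩
    have := hEK hy
    rw [← hLK] at this
    obtain ⟨n, hn⟩ := mem_iUnion.1 this
    exact mem_iUnion.2 ⟨n, mem_univ _, hn⟩
  · intro H
    refine smz_of_compact fun p hp => ?_
    exact H _ ⟨_, subset_rfl, (isCompact_vanishSet p).isSigmaCompact, hp⟩
end

section
/- Let X be a metric space. Then H̄^h(X) = 0 for every gauge h if and only if X has the following property: for every sequence (ε_n)_{n∈ω} of positive real numbers there is a γ-groupable cover (U_n)_{n∈ω} of X with diam U_n ≤ ε_n for all n. -/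
open Set Filter Topology
open scoped ENNReal Pointwise

theorem aux_antitone (ε : ℕ → ℝ) (hε : ∀ n, 0 < ε n) :
    ∃ e : ℕ → ℝ, Antitone e ∧ (∀ n, 0 < e n) ∧ ∀ n, e n ≤ ε n := by
  let e : ℕ → ℝ := fun n => Nat.rec (ε 0) (fun n r => min r (ε (n+1))) n
  have es : ∀ n, e (n+1) = min (e n) (ε (n+1)) := fun n => rfl
  refine ⟨e, antitone_nat_of_succ_le fun n => by rw [es]; exact min_le_left _ _, ?_, ?_⟩
  · intro n
    induction n with
    | zero => exact hε 0
    | succ n ih => rw [es]; exact lt_min ih (hε _)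
  · intro n
    cases n with
    | zero => exact le_refl _
    | succ n => rw [es]; exact min_le_right _ _

theorem aux_gauge (e : ℕ → ℝ) (he : ∀ n, 0 < e n) :
    ∃ h : ℝ → ℝ, IsGauge h ∧ ∀ m r, e m ≤ r → (1/2 : ℝ)^m ≤ h r := by
  let f : ℕ → ℝ → ℝ := fun m r => (1/2 : ℝ)^m * min 1 (|r| / e m)
  have f0 : ∀ m r, 0 ≤ f m r := fun m r => by
    have := he m
    simp only [f]; positivity
  have f1 : ∀ m r, f m r ≤ (1/2 : ℝ)^m := fun m r =>
    mul_le_of_le_one_right (by positivity) (min_le_left _ _)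
  have hs : ∀ r, Summable fun m => f m r := fun r =>
    Summable.of_nonneg_of_le (fun m => f0 m r) (fun m => f1 m r) summable_geometric_two
  have hc : Continuous fun r => ∑' m, f m r := by
    refine continuous_tsum (fun m => ?_) summable_geometric_two (fun m r => ?_)
    · simp only [f]; fun_prop
    · rw [Real.norm_of_nonneg (f0 m r)]; exact f1 m r
  refine ⟨fun r => ∑' m, f m r, ⟨fun r _ => tsum_nonneg fun m => f0 m r, ?_, ?_, ?_, ?_⟩, ?_⟩
  · intro a ha b hb hab
    refine (hs a).tsum_le_tsum (fun m => ?_) (hs b)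
    have := he m
    have ha' : (0:ℝ) ≤ a := ha
    have hb' : (0:ℝ) ≤ b := hb
    simp only [f, abs_of_nonneg ha', abs_of_nonneg hb']
    gcongr
  · intro r _
    exact hc.continuousWithinAt
  · simp [f]
  · intro r hr
    refine (hs r).tsum_pos (fun m => f0 m r) 0 ?_
    have := he 0
    simp only [f]
    positivity
  · intro m r hr
    have hm := he m
    have : (1/2:ℝ)^m = f m r := by
      simp only [f]
      rw [min_eq_left, mul_one]
      rw [le_div_iff₀ hm, one_mul]
      exact hr.trans (le_abs_self r)
    rw [this]
    exact (hs r).le_tsum m (fun j _ => f0 j r)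

theorem aux_sort {N : ℕ} (d : Fin N → ℝ) : ∃ σ : Equiv.Perm (Fin N), Antitone (d ∘ σ) := by
  refine ⟨Tuple.sort (fun i => - d i), fun a b hab => ?_⟩
  have := Tuple.monotone_sort (fun i => - d i) hab
  simpa using this

def CovP {X : Type*} [PseudoEMetricSpace X] (e : ℕ → ℝ) (B : Set X) : Prop :=
  ∀ s : ℕ, ∃ t, s < t ∧ ∃ U : ℕ → Set X, (∀ n, EMetric.diam (U n) ≤ ENNReal.ofReal (e n)) ∧
    ∀ x ∈ B, ∃ n, s ≤ n ∧ n < t ∧ x ∈ U n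

theorem CovP.union {X : Type*} [PseudoEMetricSpace X] {e : ℕ → ℝ} {A B : Set X}
    (hA : CovP e A) (hB : CovP e B) : CovP e (A ∪ B) := by
  intro s
  obtain ⟨t, hst, U, hU, hUA⟩ := hA s
  obtain ⟨u, htu, V, hV, hVB⟩ := hB t
  refine ⟨u, hst.trans htu, fun n => if n < t then U n else V n, ?_, ?_⟩
  · intro n
    dsimp only
    split_ifs
    · exact hU n
    · exact hV n
  · rintro x (hx | hx)
    · obtain ⟨n, h1, h2, h3⟩ := hUA x hx
      exact ⟨n, h1, h2.trans htu, by simpa [h2] using h3⟩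
    · obtain ⟨n, h1, h2, h3⟩ := hVB x hx
      exact ⟨n, hst.le.trans h1, h2, by simpa [not_lt.2 h1] using h3⟩

theorem aux_block {X : Type*} [PseudoEMetricSpace X] {e : ℕ → ℝ} (ha : Antitone e)
    (he : ∀ n, 0 < e n) {h : ℝ → ℝ} (hg : IsGauge h)
    (hh : ∀ m r, e (2 * 2^(m+1)) ≤ r → (1/2 : ℝ)^m ≤ h r) {A : Set X}
    (hA : upperH0 h A < 1) : CovP e A := by
  intro s
  have h1 := lt_of_le_of_lt (le_iSup₂ (f := fun (δ : ℝ) (_ : 0 < δ) =>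
    ⨅ (N : ℕ) (U : ℕ → Set X) (_ : A ⊆ ⋃ n ∈ Finset.range N, U n)
      (_ : ∀ n ∈ Finset.range N, EMetric.diam (U n) ≤ ENNReal.ofReal δ),
      ∑ n ∈ Finset.range N, ENNReal.ofReal (h (EMetric.diam (U n)).toReal))
      (e (2 * s)) (he _)) hA
  simp only [iInf_lt_iff] at h1
  obtain ⟨N, E, hAE, hE, hsum⟩ := h1
  let d : Fin N → ℝ := fun i => (EMetric.diam (E i)).toReal
  have hd0 : ∀ i, 0 ≤ d i := fun i => ENNReal.toReal_nonneg
  have hdE : ∀ i : Fin N, EMetric.diam (E i) = ENNReal.ofReal (d i) := fun i =>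
    (ENNReal.ofReal_toReal (ne_top_of_le_ne_top ENNReal.ofReal_ne_top
      (hE i (Finset.mem_range.2 i.2)))).symm
  have hds : ∀ i, d i ≤ e (2 * s) := fun i =>
    ENNReal.toReal_le_of_le_ofReal (he _).le (hE i (Finset.mem_range.2 i.2))
  have hsum' : ∑ i, h (d i) < 1 := by
    rw [Finset.sum_range (fun n => ENNReal.ofReal (h (EMetric.diam (E n)).toReal)),
      ← ENNReal.ofReal_sum_of_nonneg (fun i _ => hg.nonneg _ (hd0 i))] at hsum
    rwa [ENNReal.ofReal_lt_one] at hsum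
  obtain ⟨σ, hσ⟩ := aux_sort d
  have key : ∀ i : Fin N, ((i:ℕ) + 1 : ℝ) * h (d (σ i)) < 1 := by
    intro i
    refine lt_of_le_of_lt ?_ hsum'
    rw [← Equiv.sum_comp σ]
    calc ((i:ℕ) + 1 : ℝ) * h (d (σ i)) = ∑ _l ∈ Finset.Iic i, h (d (σ i)) := by
          simp
      _ ≤ ∑ l ∈ Finset.Iic i, h (d (σ l)) := by
          refine Finset.sum_le_sum fun l hl => hg.mono (hd0 _) (hd0 _) (hσ (Finset.mem_Iic.1 hl))
      _ ≤ _ := Finset.sum_le_sum_of_subset_of_nonneg (Finset.subset_univ _)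
          (fun l _ _ => hg.nonneg _ (hd0 _))
  have key2 : ∀ i : Fin N, d (σ i) ≤ e (s + i) := by
    intro i
    rcases lt_or_ge (i:ℕ) s with hi | hi
    · exact (hds _).trans (ha (by omega))
    · by_contra hcon
      push Not at hcon
      have hm1 : 2 ^ (Nat.log 2 ((i:ℕ)+1)) ≤ (i:ℕ) + 1 := Nat.pow_log_le_self 2 (by omega)
      have hm2 : (i:ℕ) + 1 < 2 ^ (Nat.log 2 ((i:ℕ)+1) + 1) := Nat.lt_pow_succ_log_self (by omega) _
      set m := Nat.log 2 ((i:ℕ)+1)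
      have h2 := hh m (d (σ i)) ((ha (by omega)).trans hcon.le)
      have h3 := key i
      have hm1' : (2:ℝ)^m ≤ (i:ℕ) + 1 := by exact_mod_cast hm1
      have : (2:ℝ)^m * (1/2)^m ≤ ((i:ℕ) + 1) * h (d (σ i)) := by gcongr
      rw [← mul_pow] at this
      norm_num at this
      linarith
  refine ⟨s + N + 1, by omega,
    fun n => if hn : n - s < N then (if s ≤ n then E (σ ⟨n - s, hn⟩) else ∅) else ∅, ?_, ?_⟩
  · intro n
    dsimp only
    split_ifs with h1 h2
    · rw [hdE]
      refine ENNReal.ofReal_le_ofReal ((key2 ⟨n - s, h1⟩).trans (ha ?_))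
      show n ≤ s + (n - s)
      omega
    · rw [show EMetric.diam (∅ : Set X) = 0 from Metric.ediam_empty]; exact zero_le
    · rw [show EMetric.diam (∅ : Set X) = 0 from Metric.ediam_empty]; exact zero_le
  · intro x hx
    have := hAE hx
    simp only [mem_iUnion, Finset.mem_range] at this
    obtain ⟨i, hi, hxi⟩ := this
    refine ⟨s + (σ.symm ⟨i, hi⟩ : Fin N), by omega, by omega, ?_⟩
    have h3 : s + ((σ.symm ⟨i, hi⟩ : Fin N) : ℕ) - s = (σ.symm ⟨i, hi⟩ : Fin N) := by omega
    simp [h3, hxi]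

theorem aux_glue {X : Type*} [PseudoEMetricSpace X] {e : ℕ → ℝ} {A : ℕ → Set X}
    (hA : ∀ n, CovP e (A n)) (hcov : ∀ x, ∃ n, x ∈ A n) :
    ∃ U : ℕ → Set X, IsGammaGroupableCover (Set.univ : Set X) U ∧
      ∀ n, EMetric.diam (U n) ≤ ENNReal.ofReal (e n) := by
  have hB : ∀ j, CovP e (accumulate A j) := by
    intro j
    induction j with
    | zero => simpa [accumulate] using hA 0
    | succ j ih => rw [accumulate_succ]; exact ih.union (hA _)
  choose T hT V hV hVB using hB
  let k : ℕ → ℕ := fun j => Nat.rec 0 (fun j r => T j r) j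
  have ks : ∀ j, k (j+1) = T j (k j) := fun j => rfl
  have hk : StrictMono k := strictMono_nat_of_lt_succ fun j => by rw [ks]; exact hT _ _
  have hex : ∀ n, ∃ j, k j ≤ n ∧ n < k (j+1) := by
    intro n
    induction n with
    | zero => exact ⟨0, le_refl _, lt_of_le_of_lt (Nat.zero_le _) (hk (Nat.lt_succ_self 0))⟩
    | succ n ih =>
      obtain ⟨j, h1, h2⟩ := ih
      rcases Nat.lt_or_ge (n+1) (k (j+1)) with h | h
      · exact ⟨j, by omega, h⟩
      · exact ⟨j+1, h, lt_of_le_of_lt h2 (hk (Nat.lt_succ_self (j+1)))⟩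
  choose J hJ1 hJ2 using hex
  refine ⟨fun n => V (J n) (k (J n)) n, ⟨k, rfl, hk, ?_⟩, fun n => hV _ _ n⟩
  intro x _
  obtain ⟨m, hm⟩ := hcov x
  filter_upwards [eventually_ge_atTop m] with j hj
  obtain ⟨n, h1, h2, h3⟩ := hVB j (k j) x (mem_accumulate.2 ⟨m, hj, hm⟩)
  refine ⟨n, h1, h2, ?_⟩
  have e1 : J n < j + 1 := hk.lt_iff_lt.1 (lt_of_le_of_lt (hJ1 n) h2)
  have e2 : j < J n + 1 := hk.lt_iff_lt.1 (lt_of_le_of_lt h1 (hJ2 n))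
  have : J n = j := by omega
  simpa [this] using h3

theorem aux_forward {X : Type*} [PseudoEMetricSpace X]
    (H : ∀ h : ℝ → ℝ, IsGauge h → upperH h (Set.univ : Set X) = 0)
    (ε : ℕ → ℝ) (hε : ∀ n, 0 < ε n) :
    ∃ U : ℕ → Set X, IsGammaGroupableCover (Set.univ : Set X) U ∧
      ∀ n, EMetric.diam (U n) ≤ ENNReal.ofReal (ε n) := by
  obtain ⟨e, ha, he, hle⟩ := aux_antitone ε hε
  obtain ⟨h, hg, hh⟩ := aux_gauge (fun m => e (2 * 2^(m+1))) (fun m => he _)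
  have h0 : upperH h (Set.univ : Set X) < 1 := by rw [H h hg]; exact one_pos
  simp only [upperH, iInf_lt_iff] at h0
  obtain ⟨A, hA, hs⟩ := h0
  obtain ⟨U, hU, hd⟩ := aux_glue (e := e) (A := A)
    (fun n => aux_block ha he hg hh (lt_of_le_of_lt (ENNReal.le_tsum n) hs))
    (fun x => by simpa using hA (mem_univ x))
  exact ⟨U, hU, fun n => (hd n).trans (ENNReal.ofReal_le_ofReal (hle n))⟩

theorem aux_backward {X : Type*} [PseudoEMetricSpace X]
    (H : ∀ ε : ℕ → ℝ, (∀ n, 0 < ε n) →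
        ∃ U : ℕ → Set X, IsGammaGroupableCover (Set.univ : Set X) U ∧
          ∀ n, EMetric.diam (U n) ≤ ENNReal.ofReal (ε n))
    (h : ℝ → ℝ) (hg : IsGauge h) : upperH h (Set.univ : Set X) = 0 := by
  have hex : ∀ n : ℕ, ∃ r : ℝ, 0 < r ∧ r ≤ (1/2)^n ∧ h r ≤ (1/2)^n := by
    intro n
    have hp : (0:ℝ) < (1/2)^n := by positivity
    have hc := hg.rightCont 0 le_rfl
    rw [ContinuousWithinAt, hg.zero] at hc
    have h1 := hc.eventually (gt_mem_nhds hp)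
    have h2 : ∀ᶠ r : ℝ in 𝓝[>] 0, r ∈ Ioc (0:ℝ) ((1/2)^n) := Ioc_mem_nhdsGT hp
    obtain ⟨r, hr1, hr2⟩ := (h1.and h2).exists
    exact ⟨r, hr2.1, hr2.2, hr1.le⟩
  choose ε hε hε1 hε2 using hex
  obtain ⟨U, ⟨k, k0, hk, hU⟩, hd⟩ := H ε hε
  let A : ℕ → Set X := fun m => {x | ∀ j ≥ m, ∃ n, k j ≤ n ∧ n < k (j + 1) ∧ x ∈ U n}
  have hA : (Set.univ : Set X) ⊆ ⋃ m, A m := by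
    intro x hx
    obtain ⟨m, hm⟩ := eventually_atTop.1 (hU x hx)
    exact mem_iUnion.2 ⟨m, hm⟩
  have hterm : ∀ n, ENNReal.ofReal (h (EMetric.diam (U n)).toReal) ≤
      ENNReal.ofReal ((1/2)^n) := fun n =>
    ENNReal.ofReal_le_ofReal ((hg.mono ENNReal.toReal_nonneg (hε n).le
      (ENNReal.toReal_le_of_le_ofReal (hε n).le (hd n))).trans (hε2 n))
  have hsm : ∑' n : ℕ, ENNReal.ofReal ((1/2)^n) ≠ ⊤ := summable_geometric_two.tsum_ofReal_ne_top
  have hz : ∀ m, upperH0 h (A m) = 0 := by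
    intro m
    refine le_antisymm (iSup₂_le fun δ hδ => ?_) zero_le
    refine ENNReal.le_of_forall_pos_le_add fun η hη _ => ?_
    rw [zero_add]
    have t1 := (ENNReal.tendsto_sum_nat_add _ hsm).comp hk.tendsto_atTop
    have t2 : Tendsto (fun j => (1/2:ℝ)^(k j)) atTop (𝓝 0) :=
      (tendsto_pow_atTop_nhds_zero_of_lt_one (by norm_num) (by norm_num)).comp hk.tendsto_atTop
    have hη' : (0:ℝ≥0∞) < η := by exact_mod_cast hη
    obtain ⟨j, ⟨hj1, hj2⟩, hj3⟩ := (((t1.eventually (gt_mem_nhds hη')).and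
      (t2.eventually (gt_mem_nhds hδ))).and (eventually_ge_atTop m)).exists
    have hkj := hk (Nat.lt_succ_self j)
    refine iInf_le_of_le (k (j+1) - k j) ?_
    refine iInf_le_of_le (fun i => U (i + k j)) ?_
    refine iInf_le_of_le ?_ (iInf_le_of_le ?_ ?_)
    · intro x hx
      obtain ⟨n, h1, h2, h3⟩ := hx j hj3
      simp only [mem_iUnion, Finset.mem_range]
      exact ⟨n - k j, by omega, by rwa [Nat.sub_add_cancel h1]⟩
    · intro n _
      refine (hd _).trans (ENNReal.ofReal_le_ofReal ((hε1 _).trans (le_trans ?_ hj2.le)))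
      exact pow_le_pow_of_le_one (by norm_num) (by norm_num) (by omega)
    · refine (Finset.sum_le_sum fun n _ => hterm (n + k j)).trans ?_
      exact (ENNReal.sum_le_tsum (f := fun n => ENNReal.ofReal ((1/2)^(n + k j))) _).trans hj1.le
  refine le_antisymm ((iInf₂_le A hA).trans ?_) zero_le
  simp [hz]

/-- `H̄^h(X) = 0` for every gauge `h` iff for every sequence of positive reals
there is a γ-groupable cover of `X` with the prescribed diameters. -/
theorem upperH_zero_iff_gamma_groupable_covers {X : Type*} [MetricSpace X] :
    (∀ h : ℝ → ℝ, IsGauge h → upperH h (Set.univ : Set X) = 0) ↔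
      (∀ ε : ℕ → ℝ, (∀ n, 0 < ε n) →
        ∃ U : ℕ → Set X, IsGammaGroupableCover (Set.univ : Set X) U ∧
          ∀ n, EMetric.diam (U n) ≤ ENNReal.ofReal (ε n)) := by
  exact ⟨aux_forward, aux_backward⟩
end

section
/- Let X and Y be metric spaces and equip X × Y with the maximum metric. (i) If X and Y both have sharp measure zero, then X × Y has sharp measure zero. (ii) If X has strong measure zero and Y has sharp measure zero, then X × Y has strong measure zero. -/
open Set Filter Topology
open scoped ENNReal Pointwise

theorem aux_block_s17 (k : ℕ → ℕ) (h0 : k 0 = 0) (hk : StrictMono k) :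
    ∃ J : ℕ → ℕ, ∀ n j, k j ≤ n → n < k (j + 1) → J n = j := by
  refine ⟨fun n => Nat.findGreatest (fun j => k j ≤ n) n, fun n j h1 h2 => ?_⟩
  rw [Nat.findGreatest_eq_iff]
  refine ⟨(hk.id_le j).trans h1, fun _ => h1, fun m hm _ hmn => ?_⟩
  have := hk.monotone (Nat.succ_le_of_lt hm)
  simp only [Nat.succ_eq_add_one] at this
  omega

theorem aux_exists_block (k : ℕ → ℕ) (h0 : k 0 = 0) (hk : StrictMono k) (n : ℕ) :
    ∃ j, k j ≤ n ∧ n < k (j + 1) := by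
  refine ⟨Nat.findGreatest (fun j => k j ≤ n) n, ?_, ?_⟩
  · exact Nat.findGreatest_spec (P := fun j => k j ≤ n) (Nat.zero_le n) (by simp [h0])
  · by_contra hcon
    push Not at hcon
    have := Nat.le_findGreatest (P := fun j => k j ≤ n) ((hk.id_le _).trans hcon) hcon
    simp only [id] at this
    omega

theorem aux_eta (k : ℕ → ℕ) (hk : StrictMono k) (ε : ℕ → ℝ) (hε : ∀ n, 0 < ε n) :
    ∃ η : ℕ → ℝ, (∀ j, 0 < η j) ∧ ∀ j n, k j ≤ n → n < k (j + 1) → η j ≤ ε n := by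
  have : ∀ j, ∃ e : ℝ, 0 < e ∧ ∀ n, k j ≤ n → n < k (j + 1) → e ≤ ε n := by
    intro j
    obtain ⟨m, -, hm⟩ := Finset.exists_min_image (Finset.Ico (k j) (k (j + 1))) ε
      ⟨k j, by simp [hk (Nat.lt_succ_self j)]⟩
    exact ⟨ε m, hε m, fun n h1 h2 => hm n (by simp [h1, h2])⟩
  choose η h1 h2 using this
  exact ⟨η, h1, h2⟩

theorem aux_diam {X Y : Type*} [MetricSpace X] [MetricSpace Y] (A : Set X) (B : Set Y)
    (c : ℝ≥0∞) (hA : EMetric.diam A ≤ c) (hB : EMetric.diam B ≤ c) :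
    EMetric.diam (A ×ˢ B) ≤ c := by
  refine Metric.ediam_le fun p hp q hq => ?_
  rw [Prod.edist_eq]
  exact max_le ((Metric.edist_le_ediam_of_mem hp.1 hq.1).trans hA)
    ((Metric.edist_le_ediam_of_mem hp.2 hq.2).trans hB)

theorem aux_io {X : Type*} [MetricSpace X] (h : SmzMetric (Set.univ : Set X))
    (η : ℕ → ℝ) (hη : ∀ n, 0 < η n) :
    ∃ U : ℕ → Set X, (∀ x, ∀ N, ∃ j, N ≤ j ∧ x ∈ U j) ∧
      ∀ n, EMetric.diam (U n) ≤ ENNReal.ofReal (η n) := by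
  choose U hU hd using fun a => h (fun b => η (Nat.pair a b)) (fun b => hη _)
  refine ⟨fun n => U n.unpair.1 n.unpair.2, fun x N => ?_, fun n => ?_⟩
  · obtain ⟨b, hb⟩ := Set.mem_iUnion.1 (hU N (Set.mem_univ x))
    exact ⟨Nat.pair N b, Nat.left_le_pair N b, by simpa using hb⟩
  · simpa using hd n.unpair.1 n.unpair.2

/-- products of sharp measure zero spaces are sharp measure zero, and the product
of an Smz space with a sharp measure zero space is Smz (maximum metric on the product). -/
theorem smzSharp_products {X Y : Type*} [MetricSpace X] [MetricSpace Y] :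
    ((SmzSharp (Set.univ : Set X) ∧ SmzSharp (Set.univ : Set Y)) →
      SmzSharp (Set.univ : Set (X × Y))) ∧
    ((SmzMetric (Set.univ : Set X) ∧ SmzSharp (Set.univ : Set Y)) →
      SmzMetric (Set.univ : Set (X × Y))) := by
  constructor
  · rintro ⟨hX, hY⟩ ε hε
    obtain ⟨V, ⟨k, h0, hk, hV⟩, hVd⟩ := hY ε hε
    obtain ⟨η, hη, hηε⟩ := aux_eta k hk ε hε
    obtain ⟨J, hJ⟩ := aux_block_s17 k h0 hk
    obtain ⟨U, ⟨l, l0, hl, hU⟩, hUd⟩ := hX η hη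
    refine ⟨fun n => U (J n) ×ˢ V n, ⟨fun i => k (l i), by simp [h0, l0], hk.comp hl, ?_⟩, ?_⟩
    · rintro ⟨x, y⟩ -
      obtain ⟨N, hN⟩ := eventually_atTop.1 (hV y (Set.mem_univ y))
      filter_upwards [hU x (Set.mem_univ x), eventually_ge_atTop N] with i hi hiN
      obtain ⟨j, hj1, hj2, hxj⟩ := hi
      obtain ⟨n, hn1, hn2, hyn⟩ := hN j ((hiN.trans (hl.id_le i)).trans hj1)
      refine ⟨n, (hk.monotone hj1).trans hn1, hn2.trans_le (hk.monotone hj2), ?_, hyn⟩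
      simpa [hJ n j hn1 hn2] using hxj
    · intro n
      obtain ⟨j, hj1, hj2⟩ := aux_exists_block k h0 hk n
      refine aux_diam _ _ _ ?_ (hVd n)
      rw [hJ n j hj1 hj2]
      exact (hUd j).trans (ENNReal.ofReal_le_ofReal (hηε j n hj1 hj2))
  · rintro ⟨hX, hY⟩ ε hε
    obtain ⟨V, ⟨k, h0, hk, hV⟩, hVd⟩ := hY ε hε
    obtain ⟨η, hη, hηε⟩ := aux_eta k hk ε hε
    obtain ⟨J, hJ⟩ := aux_block_s17 k h0 hk
    obtain ⟨U, hU, hUd⟩ := aux_io hX η hη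
    refine ⟨fun n => U (J n) ×ˢ V n, ?_, ?_⟩
    · rintro ⟨x, y⟩ -
      obtain ⟨N, hN⟩ := eventually_atTop.1 (hV y (Set.mem_univ y))
      obtain ⟨j, hj, hxj⟩ := hU x N
      obtain ⟨n, hn1, hn2, hyn⟩ := hN j hj
      refine Set.mem_iUnion.2 ⟨n, ?_, hyn⟩
      simpa [hJ n j hn1 hn2] using hxj
    · intro n
      obtain ⟨j, hj1, hj2⟩ := aux_exists_block k h0 hk n
      refine aux_diam _ _ _ ?_ (hVd n)
      rw [hJ n j hj1 hj2]
      exact (hUd j).trans (ENNReal.ofReal_le_ofReal (hηε j n hj1 hj2))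
end

section
/- Consider the Cantor set 2^ℕ as a compact topological group under coordinatewise addition modulo 2, equipped with the metric of least difference. A set S ⊆ 2^ℕ has sharp measure zero if and only if S is meager-additive, i.e., S + M is meager for every meager set M ⊆ 2^ℕ. -/
open Set Filter Topology
open scoped ENNReal Pointwise

local instance : TopologicalSpace (ZMod 2) := ⊥
local instance : DiscreteTopology (ZMod 2) := ⟨rfl⟩

attribute [local instance] PiNat.metricSpace

theorem mac_block (a : ℕ → ℕ) (ha : StrictMono a) (h0 : a 0 = 0) :
    ∃ κ : ℕ → ℕ, (∀ n, a (κ n) ≤ n ∧ n < a (κ n + 1)) ∧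
      ∀ n k, a k ≤ n → n < a (k + 1) → κ n = k := by
  have h1 : ∀ n, ∃ k, a k ≤ n ∧ n < a (k + 1) := by
    intro n
    refine ⟨Nat.findGreatest (fun k => a k ≤ n) n, ?_, ?_⟩
    · exact Nat.findGreatest_spec (P := fun k => a k ≤ n) (Nat.zero_le n) (by simp [h0])
    · by_contra h
      push Not at h
      have h2 := Nat.le_findGreatest (P := fun k => a k ≤ n) (le_trans (ha.le_apply) h) h
      omega
  choose κ hκ using h1
  refine ⟨κ, hκ, fun n k h2 h3 => ?_⟩
  have h4 := hκ n
  have h5 : κ n < k + 1 := ha.lt_iff_lt.1 (lt_of_le_of_lt h4.1 h3)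
  have h6 : k < κ n + 1 := ha.lt_iff_lt.1 (lt_of_le_of_lt h2 h4.2)
  omega

theorem mac_isOpen (v : ℕ → ZMod 2) (b c : ℕ) :
    IsOpen {z : ℕ → ZMod 2 | ∀ i, b ≤ i → i < c → z i = v i} := by
  have : {z : ℕ → ZMod 2 | ∀ i, b ≤ i → i < c → z i = v i} =
      ⋂ i ∈ Set.Ico b c, {z : ℕ → ZMod 2 | z i = v i} := by
    ext z; simp
  rw [this]
  refine (Set.finite_Ico b c).isOpen_biInter fun i _ => ?_
  have hc : Continuous (fun z : ℕ → ZMod 2 => z i) := continuous_apply i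
  exact hc.isOpen_preimage {v i} (isOpen_discrete _)

theorem mac_nhds (U : Set (ℕ → ZMod 2)) (hU : IsOpen U) (x : ℕ → ZMod 2) (hx : x ∈ U) :
    ∃ n, ∀ z : ℕ → ZMod 2, (∀ i < n, z i = x i) → z ∈ U := by
  obtain ⟨ε, hε, h⟩ := Metric.isOpen_iff.1 hU x hx
  obtain ⟨n, hn⟩ := exists_pow_lt_of_lt_one hε (by norm_num : (1 / 2 : ℝ) < 1)
  refine ⟨n, fun z hz => h ?_⟩
  have : z ∈ PiNat.cylinder x n := fun i hi => hz i hi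
  rw [PiNat.mem_cylinder_iff_dist_le] at this
  exact Metric.mem_ball.2 (lt_of_le_of_lt this hn)

theorem mac_meagre (b : ℕ → ℕ) (hb : StrictMono b) (v : ℕ → ZMod 2) :
    IsMeagre {z : ℕ → ZMod 2 | ∀ᶠ j in atTop, ∃ i, b j ≤ i ∧ i < b (j + 1) ∧ z i ≠ v i} := by
  have key : ∀ n, (⋃ j ∈ Set.Ici n,
      {z : ℕ → ZMod 2 | ∀ i, b j ≤ i → i < b (j + 1) → z i = v i}) ∈ residual (ℕ → ZMod 2) := by
    intro n
    refine residual_of_dense_open (isOpen_biUnion fun j _ => mac_isOpen v _ _) ?_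
    rw [dense_iff_inter_open]
    rintro U hU ⟨x, hx⟩
    obtain ⟨m, hm⟩ := mac_nhds U hU x hx
    refine ⟨fun i => if i < m then x i else v i, hm _ fun i hi => by simp [hi], ?_⟩
    simp only [Set.mem_iUnion]
    refine ⟨max n m, by simp, fun i h1 _ => ?_⟩
    have : max n m ≤ b (max n m) := hb.le_apply
    have : ¬ i < m := by omega
    simp [this]
  rw [IsMeagre]
  refine Filter.mem_of_superset (countable_iInter_mem.2 key) ?_
  intro z hz
  simp only [Set.mem_compl_iff, Set.mem_setOf_eq, Filter.not_eventually]
  rw [Filter.frequently_atTop]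
  intro n
  have := Set.mem_iInter.1 hz n
  simp only [Set.mem_iUnion] at this
  obtain ⟨j, hj, h⟩ := this
  refine ⟨j, hj, ?_⟩
  rintro ⟨i, h1, h2, h3⟩
  exact h3 (h i h1 h2)

theorem mac_finite (b : ℕ) : {d : ℕ → ZMod 2 | ∀ i, b ≤ i → d i = 0}.Finite := by
  refine Set.Finite.of_injOn (f := fun d : ℕ → ZMod 2 => fun i : Fin b => d i)
    (t := Set.univ) (fun _ _ => Set.mem_univ _) ?_ Set.finite_univ
  intro d hd e he h
  funext i
  by_cases hi : i < b
  · exact congrFun h ⟨i, hi⟩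
  · rw [hd i (by omega), he i (by omega)]

theorem mac_enum (b : ℕ) : ∃ (c : ℕ) (e : ℕ → ℕ → ZMod 2), ∀ x : ℕ → ZMod 2,
    ∃ j < c, ∀ i < b, x i = e j i := by
  obtain ⟨n, e, -, he⟩ := (mac_finite b).fin_param
  refine ⟨n, fun j => if h : j < n then e ⟨j, h⟩ else 0, fun x => ?_⟩
  have : (fun i => if i < b then x i else 0) ∈ Set.range e := by
    rw [he]
    intro i hi
    simp [hi]
  obtain ⟨j, hj⟩ := this
  refine ⟨j, j.2, fun i hi => ?_⟩
  simp [hj, hi]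

theorem mac_step (V : Set (ℕ → ZMod 2)) (hV : IsOpen V) (hd : Dense V) (b : ℕ) :
    ∃ (c : ℕ) (t : ℕ → ZMod 2), ∀ z : ℕ → ZMod 2,
      (∀ i, b ≤ i → i < c → z i = t i) → z ∈ V := by
  set D := {d : ℕ → ZMod 2 | ∀ i, b ≤ i → d i = 0} with hD
  have hfin : D.Finite := mac_finite b
  have ho : ∀ d ∈ D, IsOpen ((fun x => x + d) ⁻¹' V) := fun d _ =>
    hV.preimage (continuous_id.add continuous_const)
  have hdn : ∀ d ∈ D, Dense ((fun x => x + d) ⁻¹' V) := fun d _ =>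
    hd.preimage (Homeomorph.addRight d).isOpenMap
  have hdense := dense_biInter_of_isOpen ho hfin.countable hdn
  have hopen := hfin.isOpen_biInter ho
  obtain ⟨t, ht⟩ := hdense.nonempty
  obtain ⟨c, hc⟩ := mac_nhds _ hopen t ht
  refine ⟨c, t, fun z hz => ?_⟩
  let d : ℕ → ZMod 2 := fun i => if i < b then t i - z i else 0
  have hdD : -d ∈ D := by
    intro i hi
    have : ¬ i < b := by omega
    simp [d, this]
  have h1 := hc (z + d) (by
    intro i hi
    by_cases h : i < b
    · simp [d, h]
    · simp [d, h, hz i (by omega) hi])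
  have h2 := Set.mem_iInter₂.1 h1 (-d) hdD
  simpa using h2

theorem mac_char (M : Set (ℕ → ZMod 2)) (hM : IsMeagre M) (f : ℕ → ℕ) (hf : StrictMono f)
    (hf0 : f 0 = 0) :
    ∃ (m : ℕ → ℕ) (w : ℕ → ZMod 2), m 0 = 0 ∧ StrictMono m ∧
      ∀ z ∈ M, ∀ᶠ j in atTop, ∃ i, f (m j) ≤ i ∧ i < f (m (j + 1)) ∧ z i ≠ w i := by
  obtain ⟨G, hGM, hG, hGd⟩ := mem_residual.1 hM
  obtain ⟨U, hU, rfl⟩ := hG.eq_iInter_nat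
  have hVo : ∀ n, IsOpen (⋂ i ∈ Set.Iic n, U i) := fun n =>
    (Set.finite_Iic n).isOpen_biInter fun i _ => hU i
  have hVd : ∀ n, Dense (⋂ i ∈ Set.Iic n, U i) := fun n =>
    hGd.mono fun x hx => Set.mem_iInter₂.2 fun i _ => Set.mem_iInter.1 hx i
  have step : ∀ n p, ∃ (q : ℕ) (t : ℕ → ZMod 2), p < q ∧ ∀ z : ℕ → ZMod 2,
      (∀ i, f p ≤ i → i < f q → z i = t i) → z ∈ ⋂ i ∈ Set.Iic n, U i := by
    intro n p
    obtain ⟨c, t, h⟩ := mac_step _ (hVo n) (hVd n) (f p)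
    refine ⟨max (p + 1) c, t, by omega, fun z hz => h z fun i h1 h2 => hz i h1 ?_⟩
    have : max (p + 1) c ≤ f (max (p + 1) c) := hf.le_apply
    omega
  choose q t hq ht using step
  let m : ℕ → ℕ := fun n => Nat.rec 0 (fun n p => q n p) n
  have hm : StrictMono m := strictMono_nat_of_lt_succ fun n => hq n (m n)
  obtain ⟨κ, -, hκ⟩ := mac_block (f ∘ m) (hf.comp hm) hf0
  refine ⟨m, fun i => t (κ i) (m (κ i)) i, rfl, hm, fun z hz => ?_⟩
  by_contra hcon
  rw [Filter.not_eventually, Filter.frequently_atTop] at hcon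
  refine hGM (Set.mem_iInter.2 fun n => ?_) hz
  obtain ⟨j, hj, h⟩ := hcon n
  push Not at h
  have := ht j (m j) z (by
    intro i h1 h2
    have h3 := hκ i j h1 h2
    rw [h i h1 h2, h3])
  exact Set.mem_iInter₂.1 this n hj

theorem mac_forward (S : Set (ℕ → ZMod 2)) (hS : SmzSharp S) (M : Set (ℕ → ZMod 2))
    (hM : IsMeagre M) : IsMeagre (S + M) := by
  obtain ⟨a, w, ha0, ha, hw⟩ := mac_char M hM id strictMono_id rfl
  simp only [id] at hw
  obtain ⟨U, ⟨k, hk0, hk, hkU⟩, hdiam⟩ := hS (fun n => (1 / 2) ^ a (n + 1)) (fun n => by positivity)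
  have hu : ∀ n, ∃ u : ℕ → ZMod 2, ∀ x ∈ U n, ∀ i < a (n + 1), x i = u i := by
    intro n
    rcases (U n).eq_empty_or_nonempty with h | ⟨u, hu⟩
    · exact ⟨0, by simp [h]⟩
    · refine ⟨u, fun x hx => ?_⟩
      have h1 := (EMetric.edist_le_diam_of_mem hx hu).trans (hdiam n)
      rw [edist_dist, ENNReal.ofReal_le_ofReal_iff (by positivity)] at h1
      exact PiNat.mem_cylinder_iff_dist_le.2 h1
  choose u hu using hu
  obtain ⟨κ, -, hκ⟩ := mac_block a ha ha0
  refine IsMeagre.mono ?_ (mac_meagre (a ∘ k) (ha.comp hk) (fun i => u (κ i) i + w i))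
  rintro _ ⟨x, hx, z, hz, rfl⟩
  obtain ⟨J, hJ⟩ := Filter.eventually_atTop.1 (hw z hz)
  filter_upwards [hkU x hx, Filter.eventually_ge_atTop J] with j h1 h2
  obtain ⟨n, hn1, hn2, hxn⟩ := h1
  obtain ⟨i, hi1, hi2, hi3⟩ := hJ n (le_trans h2 (le_trans hk.le_apply hn1))
  refine ⟨i, (ha.monotone hn1).trans hi1, lt_of_lt_of_le hi2 (ha.monotone hn2), ?_⟩
  rw [hκ i n hi1 hi2]
  intro h
  simp only [Pi.add_apply, hu n x hxn i hi2] at h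
  exact hi3 (add_left_cancel h)

theorem mac_blocks (S : Set (ℕ → ZMod 2))
    (hS : ∀ M : Set (ℕ → ZMod 2), IsMeagre M → IsMeagre (S + M))
    (f : ℕ → ℕ) (hf : StrictMono f) (hf0 : f 0 = 0) :
    ∃ (m : ℕ → ℕ) (w : ℕ → ZMod 2), m 0 = 0 ∧ StrictMono m ∧
      ∀ x ∈ S, ∀ᶠ j in atTop, ∃ k, m j ≤ k ∧ k < m (j + 1) ∧
        ∀ i, f k ≤ i → i < f (k + 1) → x i = w i := by
  obtain ⟨m, w, hm0, hm, h⟩ := mac_char _ (hS _ (mac_meagre f hf 0)) f hf hf0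
  refine ⟨m, w, hm0, hm, fun x hx => ?_⟩
  by_contra hcon
  obtain ⟨κ, -, hκ⟩ := mac_block (f ∘ m) (hf.comp hm) (by simp [hm0, hf0])
  obtain ⟨μ, hμ, hμ'⟩ := mac_block m hm hm0
  classical
  let bad : ℕ → Prop := fun j => ¬ ∃ k, m j ≤ k ∧ k < m (j + 1) ∧
        ∀ i, f k ≤ i → i < f (k + 1) → x i = w i
  let z : ℕ → ZMod 2 := fun i => if bad (κ i) then w i - x i else 1
  have hz : z ∈ {z : ℕ → ZMod 2 | ∀ᶠ j in atTop, ∃ i, f j ≤ i ∧ i < f (j + 1) ∧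
      z i ≠ (0 : ℕ → ZMod 2) i} := by
    refine Filter.Eventually.of_forall fun k => ?_
    have h1 := hμ k
    have hk : ∀ i, f k ≤ i → i < f (k + 1) → κ i = μ k := fun i h2 h3 =>
      hκ i (μ k) ((hf.monotone h1.1).trans h2) (lt_of_lt_of_le h3 (hf.monotone h1.2))
    by_cases hb : bad (μ k)
    · have h2 := hb
      simp only [bad] at h2
      push Not at h2
      obtain ⟨i, h3, h4, h5⟩ := h2 k h1.1 h1.2
      refine ⟨i, h3, h4, ?_⟩
      simp only [z, hk i h3 h4, hb, if_true, Pi.zero_apply]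
      exact fun h6 => h5 (sub_eq_zero.1 h6).symm
    · refine ⟨f k, le_rfl, hf (Nat.lt_succ_self k), ?_⟩
      simp [z, hk (f k) le_rfl (hf (Nat.lt_succ_self k)), hb]
  have h1 := h (x + z) (Set.add_mem_add hx hz)
  refine hcon (h1.mono fun j hj => ?_)
  by_contra hb
  obtain ⟨i, h2, h3, h4⟩ := hj
  have hb' : bad (κ i) := by rw [hκ i j h2 h3]; exact hb
  exact h4 (by simp [z, hb'])

theorem mac_backward (S : Set (ℕ → ZMod 2))
    (hS : ∀ M : Set (ℕ → ZMod 2), IsMeagre M → IsMeagre (S + M)) : SmzSharp S := by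
  intro ε hε
  have hg : ∀ B : ℕ, ∃ g : ℕ, ∀ n < B, (1 / 2 : ℝ) ^ g ≤ ε n := by
    intro B
    induction B with
    | zero => exact ⟨0, by simp⟩
    | succ B ih =>
      obtain ⟨g, hg⟩ := ih
      obtain ⟨g', hg'⟩ := exists_pow_lt_of_lt_one (hε B) (by norm_num : (1 / 2 : ℝ) < 1)
      refine ⟨max g g', fun n hn => ?_⟩
      rcases Nat.lt_succ_iff_lt_or_eq.1 hn with h | rfl
      · exact (pow_le_pow_of_le_one (by norm_num) (by norm_num) (le_max_left _ _)).trans (hg n h)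
      · exact (pow_le_pow_of_le_one (by norm_num) (by norm_num) (le_max_right _ _)).trans hg'.le
  choose g hg using hg
  choose c e he using mac_enum
  let P : ℕ → ℕ × ℕ := fun k => Nat.rec (0, 0)
    (fun _ p => (g (p.2 + c p.1 + 1) + p.1 + 1, p.2 + c p.1 + 1)) k
  let f : ℕ → ℕ := fun k => (P k).1
  let N : ℕ → ℕ := fun k => (P k).2
  have hfs : ∀ k, f (k + 1) = g (N (k + 1)) + f k + 1 := fun k => rfl
  have hNs : ∀ k, N (k + 1) = N k + c (f k) + 1 := fun k => rfl
  have hf : StrictMono f := strictMono_nat_of_lt_succ fun k => by rw [hfs]; omega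
  have hN : StrictMono N := strictMono_nat_of_lt_succ fun k => by rw [hNs]; omega
  obtain ⟨m, w, hm0, hm, h⟩ := mac_blocks S hS f hf rfl
  obtain ⟨κ, hκ, hκ'⟩ := mac_block N hN rfl
  refine ⟨fun n => {x | (∀ i < f (κ n), x i = e (f (κ n)) (n - N (κ n)) i) ∧
    ∀ i, f (κ n) ≤ i → i < f (κ n + 1) → x i = w i}, ⟨N ∘ m, by simp [hm0, N, P], hN.comp hm, ?_⟩, ?_⟩
  · intro x hx
    filter_upwards [h x hx] with j hj
    obtain ⟨k, h1, h2, h3⟩ := hj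
    obtain ⟨i, hi, hxi⟩ := he (f k) x
    have hlt : N k + i < N (k + 1) := by rw [hNs]; omega
    refine ⟨N k + i, (hN.monotone h1).trans (by omega), lt_of_lt_of_le hlt (hN.monotone h2), ?_⟩
    have hk := hκ' (N k + i) k (by omega) hlt
    simp only [Set.mem_setOf_eq, hk, Nat.add_sub_cancel_left]
    exact ⟨hxi, h3⟩
  · intro n
    refine EMetric.diam_le fun x hx y hy => ?_
    rw [edist_dist]
    refine ENNReal.ofReal_le_ofReal ?_
    have h1 : x ∈ PiNat.cylinder y (f (κ n + 1)) := by
      intro i hi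
      by_cases h2 : i < f (κ n)
      · rw [hx.1 i h2, hy.1 i h2]
      · rw [hx.2 i (by omega) hi, hy.2 i (by omega) hi]
    rw [PiNat.mem_cylinder_iff_dist_le] at h1
    refine h1.trans (le_trans ?_ (hg (N (κ n + 1)) n (hκ n).2))
    exact pow_le_pow_of_le_one (by norm_num) (by norm_num) (by rw [hfs]; omega)

/-- in the Cantor group `2^ℕ` (coordinatewise addition mod 2, least-difference
metric), a set has sharp measure zero iff it is meager-additive. -/
theorem smzSharp_iff_meager_additive_cantor (S : Set (ℕ → ZMod 2)) :
    SmzSharp S ↔ ∀ M : Set (ℕ → ZMod 2), IsMeagre M → IsMeagre (S + M) := by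
  exact ⟨mac_forward S, mac_backward S⟩
end
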